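/- arXiv:1701.01396 — 5 statements merged into one kernel-verified Lean document; each statement's English description precedes it below -/
import Mathlib

section
/- Suppose a = 0. Then there exist L₁, L₂ ∈ S₁ such that Q = L₁L₂ if and only if D₇ = 0. ([VVe1], Theorem on μ-rank in three variables, part (b)(i).) -/
/-!
STATEMENT 1: With S and Q as in STATEMENT 0 and a = 0, there exist
L₁, L₂ ∈ S₁ with Q = L₁L₂ iff D₇ = 0, where
D₇ = (μ₂₃cd² − 2def + be²)(μ₁₃μ₂₁cd² − 2def + μ₁₂μ₂₃μ₃₁be²).
-/

noncomputable section

/-- The defining relations of the skew polynomial algebra `S`: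
`z_j z_i = μ_{ij} • (z_i z_j)` for all `i, j`. -/
inductive SkewRel (k : Type*) [CommRing k] (n : ℕ) (μ : Fin n → Fin n → k) :
    FreeAlgebra k (Fin n) → FreeAlgebra k (Fin n) → Prop
  | rel (i j : Fin n) : SkewRel k n μ
      (FreeAlgebra.ι k j * FreeAlgebra.ι k i)
      (μ i j • (FreeAlgebra.ι k i * FreeAlgebra.ι k j))

/-- The skew polynomial algebra `S`, a quotient of the free algebra on `n`
generators by the two-sided ideal generated by the skew-commutation relations. -/
abbrev SkewAlg (k : Type*) [CommRing k] (n : ℕ) (μ : Fin n → Fin n → k) :=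
  RingQuot (SkewRel k n μ)

/-- The degree-one generators `z_i` of `S`. -/
def zgen (k : Type*) [CommRing k] (n : ℕ) (μ : Fin n → Fin n → k) (i : Fin n) :
    SkewAlg k n μ :=
  RingQuot.mkAlgHom k (SkewRel k n μ) (FreeAlgebra.ι k i)

lemma point_eval {k : Type*} [Field k] (μ : Fin 3 → Fin 3 → k) (α β : Fin 3 → k)
    (h : ∀ i j, α j * β i = μ i j * (α i * β j)) :
    ∃ φ : SkewAlg k 3 μ →ₐ[k] Matrix (Fin 3) (Fin 3) k,
      ∀ i, φ (zgen k 3 μ i) = !![0, α i, 0; 0, 0, β i; 0, 0, 0] := by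
  refine ⟨RingQuot.liftAlgHom k ⟨FreeAlgebra.lift k
    (fun i => !![0, α i, 0; 0, 0, β i; 0, 0, 0]), ?_⟩, ?_⟩
  · rintro _ _ ⟨i, j⟩
    simp only [map_mul, map_smul, FreeAlgebra.lift_ι_apply]
    ext x y
    fin_cases x <;> fin_cases y <;> simp [Matrix.mul_apply, Fin.sum_univ_three, h i j]
  · intro i
    simp [zgen]

lemma point_eq {k : Type*} [Field k] (μ : Fin 3 → Fin 3 → k) (α β : Fin 3 → k)
    (h : ∀ i j, α j * β i = μ i j * (α i * β j)) (a b c d e f : k) (p q : Fin 3 → k)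
    (hQ : a • (zgen k 3 μ 0) ^ 2 + b • (zgen k 3 μ 1) ^ 2 + c • (zgen k 3 μ 2) ^ 2 +
      d • (zgen k 3 μ 0 * zgen k 3 μ 1) + e • (zgen k 3 μ 0 * zgen k 3 μ 2)
        + f • (zgen k 3 μ 1 * zgen k 3 μ 2)
      = (∑ i, p i • zgen k 3 μ i) * (∑ i, q i • zgen k 3 μ i)) :
    a * (α 0 * β 0) + b * (α 1 * β 1) + c * (α 2 * β 2) + d * (α 0 * β 1)
      + e * (α 0 * β 2) + f * (α 1 * β 2)
      = (p 0 * α 0 + p 1 * α 1 + p 2 * α 2) * (q 0 * β 0 + q 1 * β 1 + q 2 * β 2) := by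
  obtain ⟨φ, hφ⟩ := point_eval μ α β h
  have := congrArg (fun M => φ M 0 2) hQ
  simpa [hφ, Fin.sum_univ_three, pow_two, Matrix.mul_apply] using this

lemma zgen_comm {k : Type*} [Field k] (μ : Fin 3 → Fin 3 → k) (i j : Fin 3) :
    zgen k 3 μ j * zgen k 3 μ i = μ i j • (zgen k 3 μ i * zgen k 3 μ j) := by
  have := RingQuot.mkAlgHom_rel k (SkewRel.rel (k := k) (n := 3) (μ := μ) i j)
  simpa [zgen] using this

/-- The coefficients of a product of two linear forms. -/
lemma prod_expand {k : Type*} [Field k] (μ : Fin 3 → Fin 3 → k)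
    (hμd : ∀ i, μ i i = 1) (p0 p1 p2 q0 q1 q2 : k) :
    (p0 • zgen k 3 μ 0 + p1 • zgen k 3 μ 1 + p2 • zgen k 3 μ 2) *
      (q0 • zgen k 3 μ 0 + q1 • zgen k 3 μ 1 + q2 • zgen k 3 μ 2) =
    (p0 * q0) • (zgen k 3 μ 0) ^ 2 + (p1 * q1) • (zgen k 3 μ 1) ^ 2
      + (p2 * q2) • (zgen k 3 μ 2) ^ 2 +
      (p0 * q1 + μ 0 1 * (p1 * q0)) • (zgen k 3 μ 0 * zgen k 3 μ 1)
      + (p0 * q2 + μ 0 2 * (p2 * q0)) • (zgen k 3 μ 0 * zgen k 3 μ 2)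
        + (p1 * q2 + μ 1 2 * (p2 * q1)) • (zgen k 3 μ 1 * zgen k 3 μ 2) := by
  simp only [add_mul, mul_add, smul_mul_smul_comm, zgen_comm μ 0 1, zgen_comm μ 0 2,
    zgen_comm μ 1 2, smul_smul, pow_two]
  module

lemma coeffs {k : Type*} [Field k] (hchar : (2 : k) ≠ 0) (μ : Fin 3 → Fin 3 → k)
    (hμd : ∀ i, μ i i = 1) (hμi : ∀ i j, μ i j * μ j i = 1)
    (a b c d e f : k) (p q : Fin 3 → k)
    (hQ : a • (zgen k 3 μ 0) ^ 2 + b • (zgen k 3 μ 1) ^ 2 + c • (zgen k 3 μ 2) ^ 2 +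
      d • (zgen k 3 μ 0 * zgen k 3 μ 1) + e • (zgen k 3 μ 0 * zgen k 3 μ 2)
        + f • (zgen k 3 μ 1 * zgen k 3 μ 2)
      = (∑ i, p i • zgen k 3 μ i) * (∑ i, q i • zgen k 3 μ i)) :
    a = p 0 * q 0 ∧ b = p 1 * q 1 ∧ c = p 2 * q 2 ∧ d = p 0 * q 1 + μ 0 1 * (p 1 * q 0) ∧
      e = p 0 * q 2 + μ 0 2 * (p 2 * q 0) ∧ f = p 1 * q 2 + μ 1 2 * (p 2 * q 1) := by
  have P := fun α β h => point_eq μ α β h a b c d e f p q hQ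
  have h0 := P ![1, 0, 0] ![1, 0, 0] (by
    intro i j; fin_cases i <;> fin_cases j <;> simp [hμd])
  have h1 := P ![0, 1, 0] ![0, 1, 0] (by
    intro i j; fin_cases i <;> fin_cases j <;> simp [hμd])
  have h2 := P ![0, 0, 1] ![0, 0, 1] (by
    intro i j; fin_cases i <;> fin_cases j <;> simp [hμd])
  have h3 := P ![1, 1, 0] ![μ 0 1, 1, 0] (by
    intro i j; fin_cases i <;> fin_cases j <;> simp [hμd, hμi])
  have h4 := P ![1, 0, 1] ![μ 0 2, 0, 1] (by
    intro i j; fin_cases i <;> fin_cases j <;> simp [hμd, hμi])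
  have h5 := P ![0, 1, 1] ![0, μ 1 2, 1] (by
    intro i j; fin_cases i <;> fin_cases j <;> simp [hμd, hμi])
  simp at h0 h1 h2 h3 h4 h5
  subst h0 h1 h2
  refine ⟨rfl, rfl, rfl, ?_, ?_, ?_⟩
  · linear_combination h3
  · linear_combination h4
  · linear_combination h5

lemma scalar_iff {k : Type*} [Field k] [IsAlgClosed k] (hchar : (2 : k) ≠ 0)
    (u v w u' v' w' b c d e f : k) (hu : u * u' = 1) (hv : v * v' = 1) (hw : w * w' = 1) :
    (∃ p0 p1 p2 q0 q1 q2 : k, 0 = p0 * q0 ∧ b = p1 * q1 ∧ c = p2 * q2 ∧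
      2 * d = p0 * q1 + u * (p1 * q0) ∧
      2 * e = p0 * q2 + v * (p2 * q0) ∧ 2 * f = p1 * q2 + w * (p2 * q1)) ↔
    (w * (c * d ^ 2) - 2 * (d * e * f) + b * e ^ 2) *
      (v * u' * (c * d ^ 2) - 2 * (d * e * f) + u * w * v' * (b * e ^ 2)) = 0 := by
  have hu0 : u ≠ 0 := left_ne_zero_of_mul_eq_one hu
  have hv0 : v ≠ 0 := left_ne_zero_of_mul_eq_one hv
  have hw0 : w ≠ 0 := left_ne_zero_of_mul_eq_one hw
  obtain rfl : u' = u⁻¹ := eq_inv_of_mul_eq_one_right hu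
  obtain rfl : v' = v⁻¹ := eq_inv_of_mul_eq_one_right hv
  constructor
  · rintro ⟨p0, p1, p2, q0, q1, q2, h0, rfl, rfl, hd, he, hf⟩
    have h4 : (2 : k) ^ 3 ≠ 0 := pow_ne_zero 3 hchar
    obtain rfl | rfl := mul_eq_zero.1 h0.symm
    · apply mul_eq_zero_of_right
      apply (mul_eq_zero.1 (?_ : (2 : k) ^ 3 * _ = 0)).resolve_left h4
      have hd' : d = u * (p1 * q0) / 2 := by field_simp; linear_combination hd
      have he' : e = v * (p2 * q0) / 2 := by field_simp; linear_combination he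
      have hf' : f = (p1 * q2 + w * (p2 * q1)) / 2 := by field_simp; linear_combination hf
      subst hd' he' hf'
      field_simp
      ring
    · apply mul_eq_zero_of_left
      apply (mul_eq_zero.1 (?_ : (2 : k) ^ 3 * _ = 0)).resolve_left h4
      have hd' : d = (p0 * q1) / 2 := by field_simp; linear_combination hd
      have he' : e = (p0 * q2) / 2 := by field_simp; linear_combination he
      have hf' : f = (p1 * q2 + w * (p2 * q1)) / 2 := by field_simp; linear_combination hf
      subst hd' he' hf'
      field_simp
      ring
  · intro h
    by_cases hd : d = 0
    · subst hd
      by_cases he : e = 0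
      · subst he
        by_cases hb : b = 0
        · subst hb
          exact ⟨0, 2 * f, c, 0, 0, 1, by simp⟩
        · obtain ⟨s, hs⟩ := IsAlgClosed.exists_pow_nat_eq (f ^ 2 - b * w * c) (n := 2) (by norm_num)
          refine ⟨0, b, (f - s) / w, 0, 1, (f + s) / b, by simp, by simp, ?_, by simp, by simp, ?_⟩
          · field_simp
            linear_combination hs
          · field_simp
            ring
      · have hb : b = 0 := by
          have : (u * w * v⁻¹ * e ^ 4) * b ^ 2 = 0 := by linear_combination h
          simpa [hu0, hv0, hw0, he] using this
        subst hb
        exact ⟨2 * e, 2 * f, c, 0, 0, 1, by simp⟩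
    · by_cases he : e = 0
      · subst he
        have hc : c = 0 := by
          have : (w * v * u⁻¹ * d ^ 4) * c ^ 2 = 0 := by linear_combination h
          simpa [hu0, hv0, hw0, hd] using this
        subst hc
        refine ⟨2 * d, b, 2 * f / w, 0, 1, 0, by simp, by simp, by simp, by simp, by simp, ?_⟩
        field_simp
        ring
      · obtain h | h := mul_eq_zero.1 h
        · refine ⟨2, b / d, c / e, 0, d, e, by simp, by field_simp, by field_simp, by simp,
            by simp, ?_⟩
          field_simp
          linear_combination -h
        · refine ⟨0, d / u, e / v, 2, b * u / d, c * v / e, by simp, by field_simp,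
            by field_simp, by field_simp; ring, by field_simp; ring, ?_⟩
          field_simp at h ⊢
          linear_combination -h

theorem stmt1 (k : Type*) [Field k] [IsAlgClosed k] (hchar : (2 : k) ≠ 0)
    (μ : Fin 3 → Fin 3 → k)
    (hμ0 : ∀ i j, μ i j ≠ 0)
    (hμd : ∀ i, μ i i = 1)
    (hμi : ∀ i j, μ i j * μ j i = 1)
    (a b c d e f : k) (ha : a = 0)
    (z : Fin 3 → SkewAlg k 3 μ) (hz : z = zgen k 3 μ)
    (Q : SkewAlg k 3 μ)
    (hQ : Q = a • (z 0) ^ 2 + b • (z 1) ^ 2 + c • (z 2) ^ 2 +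
      (2 * d) • (z 0 * z 1) + (2 * e) • (z 0 * z 2) + (2 * f) • (z 1 * z 2)) :
    (∃ L₁ ∈ Submodule.span k (Set.range z), ∃ L₂ ∈ Submodule.span k (Set.range z),
        Q = L₁ * L₂) ↔
      (μ 1 2 * (c * d ^ 2) - 2 * (d * e * f) + b * e ^ 2) *
        (μ 0 2 * μ 1 0 * (c * d ^ 2) - 2 * (d * e * f) +
          μ 0 1 * μ 1 2 * μ 2 0 * (b * e ^ 2)) = 0 := by
  subst ha hz hQ
  rw [← scalar_iff hchar (μ 0 1) (μ 0 2) (μ 1 2) (μ 1 0) (μ 2 0) (μ 2 1) b c d e f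
    (hμi 0 1) (hμi 0 2) (hμi 1 2)]
  constructor
  · rintro ⟨L₁, h₁, L₂, h₂, h⟩
    obtain ⟨p, rfl⟩ := (Submodule.mem_span_range_iff_exists_fun k).1 h₁
    obtain ⟨q, rfl⟩ := (Submodule.mem_span_range_iff_exists_fun k).1 h₂
    exact ⟨p 0, p 1, p 2, q 0, q 1, q 2, coeffs hchar μ hμd hμi _ _ _ _ _ _ p q h⟩
  · rintro ⟨p0, p1, p2, q0, q1, q2, h0, h1, h2, h3, h4, h5⟩
    have hm : ∀ x y w : k, x • zgen k 3 μ 0 + y • zgen k 3 μ 1 + w • zgen k 3 μ 2 ∈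
        Submodule.span k (Set.range (zgen k 3 μ)) := fun x y w =>
      (Submodule.mem_span_range_iff_exists_fun k).2 ⟨![x, y, w], by simp [Fin.sum_univ_three]⟩
    refine ⟨_, hm p0 p1 p2, _, hm q0 q1 q2, ?_⟩
    rw [prod_expand μ hμd, ← h0, ← h1, ← h2, ← h3, ← h4, ← h5]

end
end

section
/- Let a, b ∈ R₁ be linearly independent, let 𝔮 ⊆ R₂ be a three-dimensional subspace with ab ∉ 𝔮, and set 𝔔 = k(ab) ⊕ 𝔮 (a four-dimensional subspace of R₂). Assume 𝔔 is base-point free, assume the set F₁ ∩ F₂ of one-dimensional subspaces kq ⊆ 𝔮 (q ≠ 0) such that both the restriction of q to the hyperplane a = 0 and the restriction of q to the hyperplane b = 0 have rank at most two is finite, and assume r₁ ≤ 1, where rᵢ denotes the number of one-dimensional subspaces of 𝔔 spanned by a form of rank exactly i. Then r₂ is finite. ([SV], Theorem 2.6(a).) -/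
/-!
STATEMENT 6: [SV, Theorem 2.6(a)]. With 𝔔 = k(ab) ⊕ 𝔮 base-point free,
F₁ ∩ F₂ finite and r₁ ≤ 1, the number r₂ of one-dimensional subspaces of 𝔔
spanned by a quadratic form of rank exactly two is finite.
-/

noncomputable section

open MvPolynomial

/-- The quadratic form `xᵀNx` associated to a 4×4 matrix `N`. -/
def quadOfMat (k : Type*) [Field k] (N : Matrix (Fin 4) (Fin 4) k) :
    MvPolynomial (Fin 4) k :=
  ∑ i, ∑ j, N i j • (X i * X j)

/-- `q` has rank exactly `r`: the (unique, as char k ≠ 2) symmetric matrix `N`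
with `q = xᵀNx` has rank `r`. -/
def HasRank (k : Type*) [Field k] (q : MvPolynomial (Fin 4) k) (r : ℕ) : Prop :=
  ∃ N : Matrix (Fin 4) (Fin 4) k, N.IsSymm ∧ q = quadOfMat k N ∧ N.rank = r

/-- The restriction of `q` to the hyperplane `ℓ = 0` has rank at most `r`:
writing `q = xᵀNx` with `N` symmetric and choosing a linear isomorphism
`ι : k³ → k⁴` (given by an injective 4×3 matrix `P`) onto the kernel of `ℓ`,
the symmetric matrix `PᵀNP` of the restricted form has rank at most `r`. -/
def RestRankLE (k : Type*) [Field k] (q ℓ : MvPolynomial (Fin 4) k) (r : ℕ) : Prop :=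
  ∃ (N : Matrix (Fin 4) (Fin 4) k) (P : Matrix (Fin 4) (Fin 3) k),
    N.IsSymm ∧ q = quadOfMat k N ∧
    Function.Injective P.mulVec ∧
    (∀ v : Fin 4 → k, (∃ w, P.mulVec w = v) ↔ eval v ℓ = 0) ∧
    (P.transpose * N * P).rank ≤ r

/-- A subspace of quadratic forms is base-point free if the only common zero
in k⁴ of all its elements is 0. -/
def BPFree (k : Type*) [Field k] (𝒬 : Submodule k (MvPolynomial (Fin 4) k)) : Prop :=
  ∀ v : Fin 4 → k, (∀ q ∈ 𝒬, eval v q = 0) → v = 0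

section
open Matrix

/-- The value of the quadratic form with matrix `A` at `v`. -/
def qv {k : Type*} [Field k] {n : ℕ} (A : Matrix (Fin n) (Fin n) k) (v : Fin n → k) : k :=
  v ⬝ᵥ A *ᵥ v

section
variable {k : Type*} [Field k]

lemma qv_comb {n : ℕ} (A : Matrix (Fin n) (Fin n) k) (u w : Fin n → k) (x y : k) :
    qv A (x • u + y • w) =
      qv A u * x ^ 2 + (u ⬝ᵥ A *ᵥ w + w ⬝ᵥ A *ᵥ u) * (x * y) + qv A w * y ^ 2 := by
  simp only [qv, mulVec_add, mulVec_smul, dotProduct_add, add_dotProduct, smul_dotProduct,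
    dotProduct_smul, smul_eq_mul]
  ring

lemma qv_conj {n m : ℕ} (N : Matrix (Fin n) (Fin n) k) (P : Matrix (Fin n) (Fin m) k)
    (w : Fin m → k) : qv (Pᵀ * N * P) w = qv N (P *ᵥ w) := by
  simp only [qv]
  rw [← mulVec_mulVec, ← mulVec_mulVec, dotProduct_mulVec, vecMul_transpose]

lemma eval_quadOfMat (N : Matrix (Fin 4) (Fin 4) k) (v : Fin 4 → k) :
    eval v (quadOfMat k N) = qv N v := by
  simp only [quadOfMat, qv, map_sum, smul_eval, map_mul, eval_X, dotProduct, mulVec,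
    Finset.mul_sum]
  refine Finset.sum_congr rfl fun i _ => Finset.sum_congr rfl fun j _ => ?_
  ring

lemma symm_dot {n : ℕ} {A : Matrix (Fin n) (Fin n) k} (hA : A.IsSymm) (u w : Fin n → k) :
    u ⬝ᵥ A *ᵥ w = w ⬝ᵥ A *ᵥ u := by
  rw [dotProduct_mulVec, ← mulVec_transpose, hA.eq, dotProduct_comm]

lemma qv_inj (h2 : (2 : k) ≠ 0) {n : ℕ} {A B : Matrix (Fin n) (Fin n) k} (hA : A.IsSymm)
    (hB : B.IsSymm) (h : ∀ v, qv A v = qv B v) : A = B := by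
  have key : ∀ u w : Fin n → k, u ⬝ᵥ A *ᵥ w = u ⬝ᵥ B *ᵥ w := by
    intro u w
    have h1 := h ((1 : k) • u + (1 : k) • w)
    rw [qv_comb, qv_comb, h u, h w, symm_dot hA w u, symm_dot hB w u] at h1
    have h3 : 2 * (u ⬝ᵥ A *ᵥ w) = 2 * (u ⬝ᵥ B *ᵥ w) := by linear_combination h1
    exact mul_left_cancel₀ h2 h3
  ext i j
  have := key (Pi.single i 1) (Pi.single j 1)
  simpa using this

lemma conj_symm {n m : ℕ} {N : Matrix (Fin n) (Fin n) k} (hN : N.IsSymm)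
    (P : Matrix (Fin n) (Fin m) k) : (Pᵀ * N * P).IsSymm := by
  unfold Matrix.IsSymm
  simp [Matrix.transpose_mul, hN.eq, Matrix.mul_assoc]

lemma lin_rep {a : MvPolynomial (Fin 4) k} (ha : a ∈ homogeneousSubmodule (Fin 4) k 1) :
    ∃ α : Fin 4 → k, a = ∑ i, α i • X i := by
  rw [homogeneousSubmodule_one_eq_span_X] at ha
  obtain ⟨c, hc⟩ := (Submodule.mem_span_range_iff_exists_fun k).1 ha
  exact ⟨c, hc.symm⟩

lemma quad_rep (h2 : (2 : k) ≠ 0) {p : MvPolynomial (Fin 4) k}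
    (hp : p ∈ homogeneousSubmodule (Fin 4) k 2) :
    ∃ N : Matrix (Fin 4) (Fin 4) k, N.IsSymm ∧ p = quadOfMat k N := by
  rw [← homogeneousSubmodule_one_pow, pow_two] at hp
  refine Submodule.mul_induction_on hp ?_ ?_
  · intro a ha b hb
    obtain ⟨α, rfl⟩ := lin_rep ha
    obtain ⟨β, rfl⟩ := lin_rep hb
    refine ⟨Matrix.of fun i j => (2 : k)⁻¹ * (α i * β j + α j * β i), ?_, ?_⟩
    · ext i j
      simp only [transpose_apply, of_apply]
      ring
    · have e1 : (∑ i, α i • (X i : MvPolynomial (Fin 4) k)) * (∑ i, β i • X i)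
          = ∑ i, ∑ j, (α i * β j) • (X i * X j) := by
        rw [Finset.sum_mul_sum]
        refine Finset.sum_congr rfl fun i _ => Finset.sum_congr rfl fun j _ => ?_
        rw [smul_mul_smul_comm]
      have e2 : (∑ i, α i • (X i : MvPolynomial (Fin 4) k)) * (∑ i, β i • X i)
          = ∑ i, ∑ j, (α j * β i) • (X i * X j) := by
        rw [e1, Finset.sum_comm]
        refine Finset.sum_congr rfl fun i _ => Finset.sum_congr rfl fun j _ => ?_
        rw [mul_comm (X j)]
      set L := (∑ i, α i • (X i : MvPolynomial (Fin 4) k)) * (∑ i, β i • X i) with hL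
      have : L = (2 : k)⁻¹ • (L + L) := by
        rw [← two_smul k L, smul_smul, inv_mul_cancel₀ h2, one_smul]
      rw [this]
      nth_rewrite 1 [e1]
      rw [e2]
      simp only [quadOfMat, of_apply, ← Finset.sum_add_distrib, Finset.smul_sum, ← add_smul,
        smul_smul]
  · rintro _ _ ⟨N, hN, rfl⟩ ⟨M, hM, rfl⟩
    refine ⟨N + M, hN.add hM, ?_⟩
    simp only [quadOfMat, Matrix.add_apply, add_smul, Finset.sum_add_distrib]

lemma ext3 {V : Type*} [AddCommGroup V] [Module k V] (hV : Module.finrank k V = 3) {v : V}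
    (hv : v ≠ 0) : ∃ p r, LinearIndependent k ![v, p, r] := by
  have h1 : LinearIndependent k ![v] := .of_subsingleton (v := ![v]) 0 hv
  obtain ⟨p, hp⟩ := exists_linearIndependent_snoc_of_lt_finrank h1 (by omega)
  have : Fin.snoc ![v] p = ![v, p] := by simp
  rw [this] at hp
  obtain ⟨r, hr⟩ := exists_linearIndependent_snoc_of_lt_finrank hp (by omega)
  refine ⟨p, r, ?_⟩
  have : Fin.snoc ![v, p] r = ![v, p, r] := by simp
  rwa [this] at hr

lemma binary_zero [IsAlgClosed k] (h2 : (2 : k) ≠ 0) (p q r : k) :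
    ∃ x y : k, (x ≠ 0 ∨ y ≠ 0) ∧ p * x ^ 2 + q * (x * y) + r * y ^ 2 = 0 := by
  by_cases hp : p = 0
  · exact ⟨1, 0, by simp, by simp [hp]⟩
  · obtain ⟨s, hs⟩ := IsAlgClosed.exists_pow_nat_eq (q ^ 2 - 4 * p * r) (n := 2) (by norm_num)
    refine ⟨(-q + s) / (2 * p), 1, by simp, ?_⟩
    field_simp
    linear_combination hs

lemma conic_degenerate [IsAlgClosed k] (h2 : (2 : k) ≠ 0) {H : Matrix (Fin 3) (Fin 3) k}
    (hH : H.IsSymm) (C : Matrix (Fin 3) (Fin 3) k) {v : Fin 3 → k} (hv : v ≠ 0)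
    (hHv : H *ᵥ v = 0) : ∃ w, w ≠ 0 ∧ qv H w = 0 ∧ qv C w = 0 := by
  obtain ⟨p, r, hli⟩ := ext3 (k := k) (by simp) hv
  obtain ⟨x, y, hxy, h0⟩ := binary_zero h2 (qv H p) (p ⬝ᵥ H *ᵥ r + r ⬝ᵥ H *ᵥ p) (qv H r)
  rw [← qv_comb] at h0
  set w := x • p + y • r with hw
  obtain ⟨s, t, hst, h1⟩ := binary_zero h2 (qv C v) (v ⬝ᵥ C *ᵥ w + w ⬝ᵥ C *ᵥ v) (qv C w)
  rw [← qv_comb] at h1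
  refine ⟨s • v + t • w, ?_, ?_, h1⟩
  · intro hz
    rw [Fintype.linearIndependent_iff] at hli
    have := hli ![s, t * x, t * y] (by
      simp only [Fin.sum_univ_three, Matrix.cons_val]
      rw [← hz, hw, smul_add, smul_smul, smul_smul, add_assoc])
    have e0 := this 0
    have e1 := this 1
    have e2 := this 2
    simp at e0 e1 e2
    grind
  · rw [qv_comb, symm_dot hH v w, h0, qv, hHv]
    simp

lemma two_conics [IsAlgClosed k] (h2 : (2 : k) ≠ 0) {A B : Matrix (Fin 3) (Fin 3) k}
    (hA : A.IsSymm) (hB : B.IsSymm) : ∃ w, w ≠ 0 ∧ qv A w = 0 ∧ qv B w = 0 := by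
  by_cases hd : B.det = 0
  · obtain ⟨v, hv, hBv⟩ := exists_mulVec_eq_zero_iff.2 hd
    obtain ⟨w, h, h', h''⟩ := conic_degenerate h2 hB A hv hBv
    exact ⟨w, h, h'', h'⟩
  · obtain ⟨μ, hμ⟩ := Module.End.exists_eigenvalue (Matrix.toLin' (B⁻¹ * A))
    obtain ⟨v, hv⟩ := hμ.exists_hasEigenvector
    have e1 : (B⁻¹ * A) *ᵥ v = μ • v := by
      have := hv.apply_eq_smul
      rwa [toLin'_apply] at this
    have e2 : A *ᵥ v = μ • B *ᵥ v := by
      rw [← mulVec_smul, ← e1, mulVec_mulVec, ← Matrix.mul_assoc,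
        Matrix.mul_nonsing_inv _ (isUnit_iff_ne_zero.2 hd), Matrix.one_mul]
    obtain ⟨w, h, h', h''⟩ := conic_degenerate h2 (H := A - μ • B) (hA.sub (hB.smul μ)) B hv.2
      (by rw [sub_mulVec, e2, smul_mulVec, sub_self])
    refine ⟨w, h, ?_, h''⟩
    simp only [qv, sub_mulVec, smul_mulVec, dotProduct_sub, dotProduct_smul] at h' h'' ⊢
    rw [h''] at h'
    simpa using h'

lemma quad_coeffs {T : Set k} (hT : T.Infinite) {A B C : k}
    (h : ∀ t ∈ T, A * t ^ 2 + B * t + C = 0) : A = 0 ∧ B = 0 ∧ C = 0 := by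
  classical
  obtain ⟨t1, h1⟩ := hT.nonempty
  obtain ⟨t2, h2, n2⟩ := hT.exists_notMem_finset {t1}
  obtain ⟨t3, h3, n3⟩ := hT.exists_notMem_finset {t1, t2}
  have e1 := h _ h1
  have e2 := h _ h2
  have e3 := h _ h3
  simp only [Finset.mem_singleton, Finset.mem_insert, not_or] at n2 n3
  have f2 : A * (t2 + t1) + B = 0 :=
    mul_left_cancel₀ (sub_ne_zero.2 n2) (by linear_combination e2 - e1)
  have f3 : A * (t3 + t1) + B = 0 :=
    mul_left_cancel₀ (sub_ne_zero.2 n3.1) (by linear_combination e3 - e1)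
  have hA : A = 0 := mul_left_cancel₀ (sub_ne_zero.2 n3.2) (by linear_combination f3 - f2)
  subst hA
  have hB : B = 0 := by linear_combination f2
  subst hB
  exact ⟨rfl, rfl, by linear_combination e1⟩

/-- Twice the matrix of `x₀x₁`. -/
def dmat (k : Type*) [Field k] : Matrix (Fin 4) (Fin 4) k :=
  !![0, 1, 0, 0; 1, 0, 0, 0; 0, 0, 0, 0; 0, 0, 0, 0]

lemma minor_zero {M : Matrix (Fin 4) (Fin 4) k} (h : M.rank ≤ 2) (r c : Fin 3 → Fin 4) :
    (M.submatrix r c).det = 0 := by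
  by_contra hd
  have h1 := rank_of_isUnit _ ((Matrix.isUnit_iff_isUnit_det _).2 (isUnit_iff_ne_zero.2 hd))
  have h3 := rank_submatrix_le M r c
  simp at h1
  omega

lemma pencil (h2 : (2 : k) ≠ 0) {M : Matrix (Fin 4) (Fin 4) k} (hM : M.IsSymm) {T : Set k} (hT : T.Infinite)
    (h : ∀ t ∈ T, (M + t • dmat k).rank ≤ 2) :
    (∀ i j, i ≠ 0 → j ≠ 0 → M i j = 0) ∨ (∀ i j, i ≠ 1 → j ≠ 1 → M i j = 0) ∨
    (M 0 0 ≠ 0 ∧ M 1 1 ≠ 0 ∧ ∀ i j, (i = 2 ∨ i = 3) → M i j = 0) := by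
  have s : ∀ i j, M i j = M j i := fun i j => hM.apply j i
  have s10 := s 1 0
  have s20 := s 2 0
  have s21 := s 2 1
  have s30 := s 3 0
  have s31 := s 3 1
  have s32 := s 3 2
  have main : ∀ i j : Fin 4, (i = 2 ∨ i = 3) → (j = 2 ∨ j = 3) →
      M i j = 0 ∧ M 0 j * M i 1 + M 1 j * M i 0 = 0 := by
    intro i j hi hj
    have key := quad_coeffs hT (A := - M i j)
      (B := -2 * M 0 1 * M i j + (M 0 j * M i 1 + M 1 j * M i 0))
      (C := M 0 0 * (M 1 1 * M i j - M 1 j * M i 1) - M 0 1 * (M 0 1 * M i j - M 1 j * M i 0)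
        + M 0 j * (M 0 1 * M i 1 - M 1 1 * M i 0)) (by
      intro t ht
      have := minor_zero (h t ht) ![0, 1, i] ![0, 1, j]
      rw [Matrix.det_fin_three] at this
      rcases hi with rfl | rfl <;> rcases hj with rfl | rfl <;>
      · simp [dmat, s10] at this
        linear_combination this)
    obtain ⟨h1, h3, -⟩ := key
    have h1' : M i j = 0 := by linear_combination -h1
    exact ⟨h1', by linear_combination h3 + 2 * M 0 1 * h1'⟩
  have cst : ∀ i : Fin 4, (i = 2 ∨ i = 3) →
      M 0 0 * M 1 i * M i 1 + M 1 1 * M 0 i * M i 0 = 0 := by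
    intro i hi
    obtain ⟨t, ht⟩ := hT.nonempty
    have := minor_zero (h t ht) ![0, 1, i] ![0, 1, i]
    rw [Matrix.det_fin_three] at this
    have m := main i i hi hi
    rcases hi with rfl | rfl <;>
    · simp [dmat, s10] at this
      grind
  have m22 := main 2 2 (by simp) (by simp)
  have m23 := main 2 3 (by simp) (by simp)
  have m33 := main 3 3 (by simp) (by simp)
  have c2 := cst 2 (by simp)
  have c3 := cst 3 (by simp)
  have p2 : M 0 2 * M 1 2 = 0 := by
    refine mul_left_cancel₀ h2 ?_
    rw [s20, s21] at m22
    linear_combination m22.2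
  have p3 : M 0 3 * M 1 3 = 0 := by
    refine mul_left_cancel₀ h2 ?_
    rw [s30, s31] at m33
    linear_combination m33.2
  have p23 : M 0 3 * M 1 2 + M 1 3 * M 0 2 = 0 := by
    rw [s20, s21] at m23
    exact m23.2
  rw [s21, s20] at c2
  rw [s31, s30] at c3
  have z22 := m22.1
  have z23 := m23.1
  have z33 := m33.1
  have z32 : M 3 2 = 0 := by rw [s32, z23]
  clear m22 m23 m33 main cst
  have fin1 : M 1 1 = 0 → M 1 2 = 0 → M 1 3 = 0 → ∀ i j, i ≠ 0 → j ≠ 0 → M i j = 0 := by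
    intro h1 h3 h4 i j hi hj
    fin_cases i <;> fin_cases j <;> simp_all
  have fin2 : M 0 0 = 0 → M 0 2 = 0 → M 0 3 = 0 → ∀ i j, i ≠ 1 → j ≠ 1 → M i j = 0 := by
    intro h1 h3 h4 i j hi hj
    fin_cases i <;> fin_cases j <;> simp_all
  by_cases a2 : M 0 2 = 0
  · by_cases a3 : M 0 3 = 0
    · by_cases b0 : M 0 0 = 0
      · exact Or.inr (Or.inl (fin2 b0 a2 a3))
      · have b2 : M 1 2 = 0 := by
          simpa [a2, b0] using c2
        have b3 : M 1 3 = 0 := by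
          simpa [a3, b0] using c3
        by_cases b1 : M 1 1 = 0
        · exact Or.inl (fin1 b1 b2 b3)
        · refine Or.inr (Or.inr ⟨b0, b1, ?_⟩)
          intro i j hi
          rcases hi with rfl | rfl <;> fin_cases j <;> simp_all
    · have b3 : M 1 3 = 0 := by simpa [a3] using p3
      have b2 : M 1 2 = 0 := by simpa [a3, a2] using p23
      have b1 : M 1 1 = 0 := by simpa [a3, b3] using c3
      exact Or.inl (fin1 b1 b2 b3)
  · have b2 : M 1 2 = 0 := by simpa [a2] using p2
    have b3 : M 1 3 = 0 := by simpa [a2, b2] using p23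
    have b1 : M 1 1 = 0 := by simpa [a2, b2] using c2
    exact Or.inl (fin1 b1 b2 b3)

lemma frame {a b : MvPolynomial (Fin 4) k} (ha : a ∈ homogeneousSubmodule (Fin 4) k 1)
    (hb : b ∈ homogeneousSubmodule (Fin 4) k 1) (hab : LinearIndependent k ![a, b]) :
    ∃ G H : Matrix (Fin 4) (Fin 4) k, G * H = 1 ∧ H * G = 1 ∧
      (∀ y, eval (G *ᵥ y) a = y 0) ∧ (∀ y, eval (G *ᵥ y) b = y 1) := by
  obtain ⟨α, rfl⟩ := lin_rep ha
  obtain ⟨β, rfl⟩ := lin_rep hb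
  have ev : ∀ (γ v : Fin 4 → k), eval v (∑ i, γ i • (X i : MvPolynomial (Fin 4) k)) = γ ⬝ᵥ v := by
    intro γ v
    simp [dotProduct, smul_eval]
  have hli : LinearIndependent k ![α, β] := by
    rw [LinearIndependent.pair_iff] at hab ⊢
    intro s t hst
    apply hab s t
    rw [Finset.smul_sum, Finset.smul_sum, ← Finset.sum_add_distrib]
    refine Finset.sum_eq_zero fun i _ => ?_
    have := congrFun hst i
    simp only [Pi.add_apply, Pi.smul_apply, smul_eq_mul, Pi.zero_apply] at this
    rw [smul_smul, smul_smul, ← add_smul, this, zero_smul]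
  obtain ⟨c, hc⟩ := exists_linearIndependent_snoc_of_lt_finrank hli (by simp)
  have : Fin.snoc ![α, β] c = ![α, β, c] := by simp
  rw [this] at hc
  obtain ⟨d, hd⟩ := exists_linearIndependent_snoc_of_lt_finrank hc (by simp)
  have : Fin.snoc ![α, β, c] d = ![α, β, c, d] := by simp
  rw [this] at hd
  have hu : IsUnit (Matrix.of ![α, β, c, d]) := linearIndependent_rows_iff_isUnit.1 hd
  set H : Matrix (Fin 4) (Fin 4) k := Matrix.of ![α, β, c, d] with hH
  have hdet := (Matrix.isUnit_iff_isUnit_det _).1 hu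
  have hHG : H * H⁻¹ = 1 := Matrix.mul_nonsing_inv _ hdet
  refine ⟨H⁻¹, H, Matrix.nonsing_inv_mul _ hdet, hHG, ?_, ?_⟩
  · intro y
    have : (H *ᵥ (H⁻¹ *ᵥ y)) 0 = y 0 := by rw [mulVec_mulVec, hHG, one_mulVec]
    rw [ev]
    exact this
  · intro y
    have : (H *ᵥ (H⁻¹ *ᵥ y)) 1 = y 1 := by rw [mulVec_mulVec, hHG, one_mulVec]
    rw [ev]
    exact this

/-- `G` with its `i`-th column removed. -/
def dropCol (G : Matrix (Fin 4) (Fin 4) k) (i : Fin 4) : Matrix (Fin 4) (Fin 3) k :=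
  G.submatrix id i.succAbove

lemma dropCol_mulVec (G : Matrix (Fin 4) (Fin 4) k) (i : Fin 4) (w : Fin 3 → k) :
    dropCol G i *ᵥ w = G *ᵥ (i.insertNth (0 : k) w : Fin 4 → k) := by
  ext j
  simp [dropCol, mulVec, dotProduct, Fin.sum_univ_succAbove _ i]

lemma mulVec_inj {G H : Matrix (Fin 4) (Fin 4) k} (hHG : H * G = 1) {u v : Fin 4 → k}
    (h : G *ᵥ u = G *ᵥ v) : u = v := by
  have := congrArg (H *ᵥ ·) h
  simpa [mulVec_mulVec, hHG] using this

lemma dropCol_inj {G H : Matrix (Fin 4) (Fin 4) k} (hHG : H * G = 1) (i : Fin 4) :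
    Function.Injective (dropCol G i).mulVec := by
  intro u v h
  rw [dropCol_mulVec, dropCol_mulVec] at h
  have := mulVec_inj hHG h
  funext j
  simpa using congrFun this (i.succAbove j)

lemma restRank (h2 : (2 : k) ≠ 0) {G H : Matrix (Fin 4) (Fin 4) k} (hGH : G * H = 1)
    (hHG : H * G = 1)
    {l : MvPolynomial (Fin 4) k} (i : Fin 4) (hl : ∀ y, eval (G *ᵥ y) l = y i)
    {q q' : MvPolynomial (Fin 4) k} (hq : q ∈ homogeneousSubmodule (Fin 4) k 2)
    (hr : HasRank k q' 2) (hqq : ∀ v, eval v l = 0 → eval v q = eval v q') :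
    RestRankLE k q l 2 := by
  obtain ⟨N, hN, hqN⟩ := quad_rep h2 hq
  obtain ⟨N', hN', hqN', hrk⟩ := hr
  have hl0 : ∀ w, eval (dropCol G i *ᵥ w) l = 0 := by
    intro w
    rw [dropCol_mulVec, hl]
    simp
  refine ⟨N, dropCol G i, hN, hqN, dropCol_inj hHG i, ?_, ?_⟩
  · intro v
    constructor
    · rintro ⟨w, rfl⟩
      exact hl0 w
    · intro hv
      have hv' : v = G *ᵥ (H *ᵥ v) := by rw [mulVec_mulVec, hGH, one_mulVec]
      rw [hv', hl] at hv
      refine ⟨fun j => (H *ᵥ v) (i.succAbove j), ?_⟩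
      rw [dropCol_mulVec]
      conv_rhs => rw [hv']
      congr 1
      rw [← hv]
      exact Fin.insertNth_self_removeNth i (H *ᵥ v)
  · have : (dropCol G i)ᵀ * N * dropCol G i = (dropCol G i)ᵀ * N' * dropCol G i := by
      apply qv_inj h2 (conj_symm hN _) (conj_symm hN' _)
      intro w
      rw [qv_conj, qv_conj, ← eval_quadOfMat, ← eval_quadOfMat, ← hqN, ← hqN']
      exact hqq _ (hl0 w)
    rw [this, ← hrk]
    exact (rank_mul_le_left _ _).trans (rank_mul_le_right _ _)

lemma hasRank_smul {p : MvPolynomial (Fin 4) k} {r : ℕ} (h : HasRank k p r) {u : k} (hu : u ≠ 0) :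
    HasRank k (u • p) r := by
  obtain ⟨N, hN, rfl, hr⟩ := h
  refine ⟨u • N, hN.smul u, ?_, ?_⟩
  · simp only [quadOfMat, Finset.smul_sum, Matrix.smul_apply, smul_smul, smul_eq_mul]
  · rw [← hr]
    apply le_antisymm
    · have : u • N = (u • (1 : Matrix (Fin 4) (Fin 4) k)) * N := by simp
      rw [this]
      exact rank_mul_le_right _ _
    · have : N = (u⁻¹ • (1 : Matrix (Fin 4) (Fin 4) k)) * (u • N) := by simp [smul_smul, hu]
      conv_lhs => rw [this]
      exact rank_mul_le_right _ _

lemma hasRank_sq {l : MvPolynomial (Fin 4) k} (hl : l ∈ homogeneousSubmodule (Fin 4) k 1)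
    (h0 : l ≠ 0) : HasRank k (l ^ 2) 1 := by
  obtain ⟨α, rfl⟩ := lin_rep hl
  refine ⟨vecMulVec α α, ?_, ?_, ?_⟩
  · unfold Matrix.IsSymm
    rw [transpose_vecMulVec]
  · rw [pow_two, Finset.sum_mul_sum]
    simp only [quadOfMat, vecMulVec_apply, smul_mul_smul_comm]
  · apply le_antisymm (rank_vecMulVec_le _ _)
    by_contra hlt
    have hz : (vecMulVec α α).rank = 0 := by omega
    rw [Matrix.rank, Submodule.finrank_eq_zero, LinearMap.range_eq_bot] at hz
    replace hz : vecMulVec α α = 0 := Matrix.ext_of_mulVec_single fun i => by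
      rw [zero_mulVec]
      exact LinearMap.congr_fun hz (Pi.single i 1)
    apply h0
    have : ∀ i, α i = 0 := by
      intro i
      have := congrFun (congrFun hz i) i
      simpa [vecMulVec_apply] using this
    simp [this]

lemma no_plane [IsAlgClosed k] (h2 : (2 : k) ≠ 0) {G H : Matrix (Fin 4) (Fin 4) k}
    (hHG : H * G = 1) (i : Fin 4)
    {p q : MvPolynomial (Fin 4) k}
    (hp : ∀ w, eval (dropCol G i *ᵥ w) p = 0)
    {𝔮 : Submodule k (MvPolynomial (Fin 4) k)}
    (h𝔮sub : 𝔮 ≤ homogeneousSubmodule (Fin 4) k 2)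
    (h𝔮dim : Module.finrank k 𝔮 = 3)
    (hbpf : BPFree k (Submodule.span k {p} ⊔ 𝔮))
    (hq : q ∈ 𝔮) (hq0 : q ≠ 0) (hqv : ∀ w, eval (dropCol G i *ᵥ w) q = 0) : False := by
  obtain ⟨⟨f, hf⟩, ⟨g, hg⟩, hli⟩ := ext3 (k := k) h𝔮dim (v := (⟨q, hq⟩ : 𝔮)) (by simpa using hq0)
  have hsp := hli.span_eq_top_of_card_eq_finrank (by simp [h𝔮dim])
  obtain ⟨F, hF, hfF⟩ := quad_rep h2 (h𝔮sub hf)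
  obtain ⟨E, hE, hgE⟩ := quad_rep h2 (h𝔮sub hg)
  obtain ⟨w, hw, h1, h3⟩ := two_conics h2 (conj_symm hF (dropCol G i)) (conj_symm hE (dropCol G i))
  rw [qv_conj, ← eval_quadOfMat, ← hfF] at h1
  rw [qv_conj, ← eval_quadOfMat, ← hgE] at h3
  have : dropCol G i *ᵥ w = 0 := by
    apply hbpf
    intro r hr
    obtain ⟨s, hs, t, ht, rfl⟩ := Submodule.mem_sup.1 hr
    obtain ⟨c, rfl⟩ := Submodule.mem_span_singleton.1 hs
    have ht' : (⟨t, ht⟩ : 𝔮) ∈ Submodule.span k (Set.range ![(⟨q, hq⟩ : 𝔮), ⟨f, hf⟩, ⟨g, hg⟩]) := by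
      rw [hsp]
      trivial
    obtain ⟨e, he⟩ := (Submodule.mem_span_range_iff_exists_fun k).1 ht'
    have he' := congrArg Subtype.val he
    simp [Fin.sum_univ_three] at he'
    rw [← he']
    simp [smul_eval, hp, hqv, h1, h3]
  exact hw (dropCol_inj hHG i (by rw [this, mulVec_zero]))

lemma key [IsAlgClosed k] (h2 : (2 : k) ≠ 0) {G H : Matrix (Fin 4) (Fin 4) k}
    (hGH : G * H = 1) (hHG : H * G = 1)
    {a b : MvPolynomial (Fin 4) k}
    (ha : a ∈ homogeneousSubmodule (Fin 4) k 1)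
    (hb : b ∈ homogeneousSubmodule (Fin 4) k 1)
    (hGa : ∀ y, eval (G *ᵥ y) a = y 0) (hGb : ∀ y, eval (G *ᵥ y) b = y 1)
    {𝔮 : Submodule k (MvPolynomial (Fin 4) k)}
    (h𝔮sub : 𝔮 ≤ homogeneousSubmodule (Fin 4) k 2)
    (h𝔮dim : Module.finrank k 𝔮 = 3)
    (hbpf : BPFree k (Submodule.span k {a * b} ⊔ 𝔮))
    (hr1 : {W : Submodule k (MvPolynomial (Fin 4) k) |
        ∃ q ∈ Submodule.span k {a * b} ⊔ 𝔮, q ≠ 0 ∧ W = Submodule.span k {q} ∧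
          HasRank k q 1}.Subsingleton)
    {q : MvPolynomial (Fin 4) k} (hq : q ∈ 𝔮) (hq0 : q ≠ 0) :
    {c : k | HasRank k (q + c • (a * b)) 2}.Finite := by
  by_contra hinf
  obtain ⟨N, hN, hqN⟩ := quad_rep h2 (h𝔮sub hq)
  set M := Gᵀ * N * G with hM
  have hMs : M.IsSymm := conj_symm hN G
  have hqM : ∀ y, eval (G *ᵥ y) q = qv M y := by
    intro y
    rw [hM, qv_conj, ← eval_quadOfMat, ← hqN]
  have hD : (dmat k).IsSymm := by
    ext i j
    fin_cases i <;> fin_cases j <;> rfl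
  have hpen := pencil h2 hMs (T := (fun c : k => 2⁻¹ * c) '' {c : k | HasRank k (q + c • (a * b)) 2})
    (Set.Infinite.image (fun x _ y _ h => mul_left_cancel₀ (inv_ne_zero h2) h) hinf) (by
      rintro _ ⟨c, ⟨N', hN', hqN', hrk⟩, rfl⟩
      have : M + (2⁻¹ * c) • dmat k = Gᵀ * N' * G := by
        apply qv_inj h2 (hMs.add (hD.smul _)) (conj_symm hN' G)
        intro y
        rw [qv_conj, ← eval_quadOfMat N', ← hqN', map_add, hqM, smul_eval, map_mul, hGa, hGb]
        have : qv (dmat k) y = 2 * (y 0 * y 1) := by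
          simp [qv, dmat, dotProduct, mulVec, Fin.sum_univ_four]
          ring
        simp only [qv, add_mulVec, smul_mulVec, dotProduct_add, dotProduct_smul, smul_eq_mul] at this ⊢
        rw [this]
        field_simp
      simp only
      rw [this, ← hrk]
      exact (rank_mul_le_left _ _).trans (rank_mul_le_right _ _))
  have plane : ∀ i : Fin 4, (i = 0 ∨ i = 1) → (∀ m n, m ≠ i → n ≠ i → M m n = 0) → False := by
    intro i hi hz
    refine no_plane h2 hHG i (p := a * b) ?_ h𝔮sub h𝔮dim hbpf hq hq0 ?_
    · intro w
      rw [dropCol_mulVec, map_mul, hGa, hGb]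
      rcases hi with rfl | rfl
      · rw [Fin.insertNth_apply_same, zero_mul]
      · rw [Fin.insertNth_apply_same, mul_zero]
    · intro w
      rw [dropCol_mulVec, hqM]
      simp only [qv, dotProduct, mulVec, Finset.mul_sum]
      refine Finset.sum_eq_zero fun m _ => Finset.sum_eq_zero fun n _ => ?_
      by_cases hm : m = i
      · subst hm
        rw [Fin.insertNth_apply_same, zero_mul]
      · by_cases hn : n = i
        · subst hn
          rw [Fin.insertNth_apply_same, mul_zero, mul_zero]
        · rw [hz m n hm hn, zero_mul, mul_zero]
  rcases hpen with h | h | ⟨h0, h1, h⟩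
  · exact plane 0 (by simp) h
  · exact plane 1 (by simp) h
  · obtain ⟨δ, hδ⟩ := IsAlgClosed.exists_pow_nat_eq (M 1 1 / M 0 0) (n := 2) (by norm_num)
    have hδ' : M 0 0 * δ ^ 2 = M 1 1 := by
      rw [hδ]
      field_simp
    have hδ0 : δ ≠ 0 := by
      rintro rfl
      apply h1
      rw [← hδ']
      simp
    have hsurj : ∀ v : Fin 4 → k, v = G *ᵥ (H *ᵥ v) := fun v => by
      rw [mulVec_mulVec, hGH, one_mulVec]
    have fact : ∀ ε : k, ε ^ 2 = δ ^ 2 →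
        M 0 0 • (a + ε • b) ^ 2 = (2 * M 0 0 * ε - 2 * M 0 1) • (a * b) + q := by
      intro ε hε
      apply MvPolynomial.funext
      intro v
      rw [hsurj v]
      simp only [smul_eval, map_add, map_pow, map_mul, hGa, hGb, hqM]
      have hh : ∀ i j, (j = 2 ∨ j = 3) → M i j = 0 := fun i j hj => by
        rw [← hMs.apply]
        exact h j i hj
      have s10 : M 1 0 = M 0 1 := hMs.apply 0 1
      simp [qv, dotProduct, mulVec, Fin.sum_univ_four, h, hh, s10]
      rw [← hδ', ← hε]
      ring
    have mem : ∀ ε : k, ε ^ 2 = δ ^ 2 → Submodule.span k {(a + ε • b) ^ 2} ∈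
        {W : Submodule k (MvPolynomial (Fin 4) k) |
        ∃ q ∈ Submodule.span k {a * b} ⊔ 𝔮, q ≠ 0 ∧ W = Submodule.span k {q} ∧
          HasRank k q 1} := by
      intro ε hε
      have hne : a + ε • b ≠ 0 := by
        intro hz
        have := congrArg (eval (G *ᵥ (Pi.single 0 1))) hz
        simp only [map_add, smul_eval, hGa, hGb] at this
        simp at this
      refine ⟨(a + ε • b) ^ 2, ?_, pow_ne_zero 2 hne, rfl,
        hasRank_sq (Submodule.add_mem _ ha (Submodule.smul_mem _ _ hb)) hne⟩
      have : (a + ε • b) ^ 2 =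
          (M 0 0)⁻¹ • ((2 * M 0 0 * ε - 2 * M 0 1) • (a * b) + q) := by
        rw [← fact ε hε, smul_smul, inv_mul_cancel₀ h0, one_smul]
      rw [this]
      exact Submodule.smul_mem _ _ (Submodule.add_mem_sup
        (Submodule.smul_mem _ _ (Submodule.mem_span_singleton_self _)) hq)
    have heq := hr1 (mem δ rfl) (mem (-δ) (by ring))
    have hin : (a + δ • b) ^ 2 ∈ Submodule.span k {(a + (-δ) • b) ^ 2} := by
      rw [← heq]
      exact Submodule.mem_span_singleton_self _
    obtain ⟨u, hu⟩ := Submodule.mem_span_singleton.1 hin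
    have e1 := congrArg (eval (G *ᵥ ![1, 0, 0, 0])) hu
    have e2 := congrArg (eval (G *ᵥ ![1, 1, 0, 0])) hu
    simp only [map_add, smul_eval, map_pow, hGa, hGb] at e1 e2
    simp at e1 e2
    subst e1
    have : 2 * (2 * δ) = 0 := by linear_combination -e2
    simp [h2, hδ0] at this
end
end

theorem stmt6 (k : Type*) [Field k] [IsAlgClosed k] (hchar : (2 : k) ≠ 0)
    (a b : MvPolynomial (Fin 4) k)
    (ha : a ∈ homogeneousSubmodule (Fin 4) k 1)
    (hb : b ∈ homogeneousSubmodule (Fin 4) k 1)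
    (hab : LinearIndependent k ![a, b])
    (𝔮 : Submodule k (MvPolynomial (Fin 4) k))
    (h𝔮sub : 𝔮 ≤ homogeneousSubmodule (Fin 4) k 2)
    (h𝔮dim : Module.finrank k 𝔮 = 3)
    (habn : a * b ∉ 𝔮)
    (𝔔 : Submodule k (MvPolynomial (Fin 4) k))
    (h𝔔 : 𝔔 = Submodule.span k {a * b} ⊔ 𝔮)
    (hbpf : BPFree k 𝔔)
    (hF : {W : Submodule k (MvPolynomial (Fin 4) k) |
        ∃ q ∈ 𝔮, q ≠ 0 ∧ W = Submodule.span k {q} ∧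
          RestRankLE k q a 2 ∧ RestRankLE k q b 2}.Finite)
    (hr1 : {W : Submodule k (MvPolynomial (Fin 4) k) |
        ∃ q ∈ 𝔔, q ≠ 0 ∧ W = Submodule.span k {q} ∧
          HasRank k q 1}.Subsingleton) :
    {W : Submodule k (MvPolynomial (Fin 4) k) |
        ∃ q ∈ 𝔔, q ≠ 0 ∧ W = Submodule.span k {q} ∧
          HasRank k q 2}.Finite := by
  subst h𝔔
  obtain ⟨G, H, hGH, hHG, hGa, hGb⟩ := frame ha hb hab
  have hch : ∀ U : Submodule k (MvPolynomial (Fin 4) k), ∃ q : MvPolynomial (Fin 4) k,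
      U ∈ {W : Submodule k (MvPolynomial (Fin 4) k) |
        ∃ q ∈ 𝔮, q ≠ 0 ∧ W = Submodule.span k {q} ∧
          RestRankLE k q a 2 ∧ RestRankLE k q b 2} →
      q ∈ 𝔮 ∧ q ≠ 0 ∧ U = Submodule.span k {q} := by
    intro U
    by_cases hU : U ∈ {W : Submodule k (MvPolynomial (Fin 4) k) |
        ∃ q ∈ 𝔮, q ≠ 0 ∧ W = Submodule.span k {q} ∧
          RestRankLE k q a 2 ∧ RestRankLE k q b 2}
    · obtain ⟨q, h1, h2, h3, -⟩ := hU
      exact ⟨q, fun _ => ⟨h1, h2, h3⟩⟩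
    · exact ⟨0, fun h => absurd h hU⟩
  choose f hf using hch
  refine Set.Finite.subset (Set.Finite.union (Set.finite_singleton (Submodule.span k {a * b}))
    (Set.Finite.biUnion hF (t := fun U => (fun c : k => Submodule.span k {f U + c • (a * b)}) ''
      {c : k | HasRank k (f U + c • (a * b)) 2}) ?_)) ?_
  · intro U hU
    obtain ⟨h1, h2, -⟩ := hf U hU
    exact (key hchar hGH hHG ha hb hGa hGb h𝔮sub h𝔮dim hbpf hr1 h1 h2).image _
  · rintro W ⟨r, hr, hr0, rfl, hrk⟩
    obtain ⟨s', hs, q, hq, rfl⟩ := Submodule.mem_sup.1 hr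
    obtain ⟨s, rfl⟩ := Submodule.mem_span_singleton.1 hs
    by_cases hq0 : q = 0
    · left
      subst hq0
      rw [add_zero] at hr0 ⊢
      have hs0 : s ≠ 0 := by
        rintro rfl
        simp at hr0
      exact Submodule.span_singleton_smul_eq (isUnit_iff_ne_zero.2 hs0) _
    · right
      have hU : Submodule.span k {q} ∈ {W : Submodule k (MvPolynomial (Fin 4) k) |
          ∃ q ∈ 𝔮, q ≠ 0 ∧ W = Submodule.span k {q} ∧
            RestRankLE k q a 2 ∧ RestRankLE k q b 2} := by
        refine ⟨q, hq, hq0, rfl, ?_, ?_⟩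
        · refine restRank hchar hGH hHG 0 hGa (h𝔮sub hq) hrk fun v hv => ?_
          simp [smul_eval, hv]
        · refine restRank hchar hGH hHG 1 hGb (h𝔮sub hq) hrk fun v hv => ?_
          simp [smul_eval, hv]
      refine Set.mem_biUnion hU ?_
      obtain ⟨h1, h2, h3⟩ := hf _ hU
      set p := f (Submodule.span k {q}) with hp
      have hqp : q ∈ Submodule.span k {p} := by
        rw [← h3]
        exact Submodule.mem_span_singleton_self _
      obtain ⟨u, hu⟩ := Submodule.mem_span_singleton.1 hqp
      have hu0 : u ≠ 0 := by
        rintro rfl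
        apply hq0
        rw [← hu, zero_smul]
      have e : p + (u⁻¹ * s) • (a * b) = u⁻¹ • (s • (a * b) + q) := by
        rw [← hu, smul_add, smul_smul, smul_smul, inv_mul_cancel₀ hu0, one_smul, add_comm]
      refine ⟨u⁻¹ * s, ?_, ?_⟩
      · change HasRank k _ 2
        rw [e]
        exact hasRank_smul hrk (inv_ne_zero hu0)
      · change Submodule.span k {p + (u⁻¹ * s) • (a * b)} = _
        rw [e]
        exact Submodule.span_singleton_smul_eq (isUnit_iff_ne_zero.2 (inv_ne_zero hu0)) _

end
end

section
/- Let a, b ∈ R₁ be linearly independent, let 𝔮 ⊆ R₂ be a three-dimensional subspace with ab ∉ 𝔮, and set 𝔔 = k(ab) ⊕ 𝔮. Assume 𝔔 is base-point free, assume the set F₁ ∩ F₂ of one-dimensional subspaces kq ⊆ 𝔮 (q ≠ 0) such that both the restriction of q to the hyperplane a = 0 and the restriction of q to the hyperplane b = 0 have rank at most two is finite with exactly m elements, and assume r₁ ≤ 1, where rᵢ denotes the number of one-dimensional subspaces of 𝔔 spanned by a form of rank exactly i. Then m − r₁ ≤ r₂ ≤ 2(m − r₁) + 1. ([SV], Theorem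 2.6(c).) -/
/-!
STATEMENT 7: [SV, Theorem 2.6(c)]. With 𝔔 = k(ab) ⊕ 𝔮 base-point free,
|F₁ ∩ F₂| = m < ∞ and r₁ ≤ 1, we have m − r₁ ≤ r₂ ≤ 2(m − r₁) + 1.
-/

noncomputable section

open MvPolynomial

section Scalars
variable {k : Type*} [Field k] [IsAlgClosed k]

theorem s7_quad_root (A B C : k) (hA : A ≠ 0) : ∃ x : k, A * x ^ 2 + B * x + C = 0 := by
  have hd : (Polynomial.C A * Polynomial.X ^ 2 + Polynomial.C B * Polynomial.X
      + Polynomial.C C).degree ≠ 0 := by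
    rw [Polynomial.degree_quadratic hA]; decide
  obtain ⟨x, hx⟩ := IsAlgClosed.exists_root _ hd
  exact ⟨x, by simpa [Polynomial.IsRoot] using hx⟩

theorem s7_cubic_root (A B C D : k) (hA : A ≠ 0) :
    ∃ x : k, A * x ^ 3 + B * x ^ 2 + C * x + D = 0 := by
  have hd : (Polynomial.C A * Polynomial.X ^ 3 + Polynomial.C B * Polynomial.X ^ 2
      + Polynomial.C C * Polynomial.X + Polynomial.C D).degree ≠ 0 := by
    rw [Polynomial.degree_cubic hA]; decide
  obtain ⟨x, hx⟩ := IsAlgClosed.exists_root _ hd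
  exact ⟨x, by simpa [Polynomial.IsRoot] using hx⟩

theorem s7_bin_factor (A B C : k) :
    ∃ p r s t : k, A = p * s ∧ C = r * t ∧ 2 * B = p * t + r * s := by
  by_cases hA : A = 0
  · exact ⟨0, 1, 2 * B, C, by simp [hA], by simp, by simp⟩
  · obtain ⟨x, hx⟩ := s7_quad_root A (2 * B) C hA
    refine ⟨A, -(A * x), 1, (2 * B + A * x) / A, by ring, ?_, ?_⟩
    · field_simp; linear_combination hx
    · field_simp; ring

theorem s7_bin_zero (A B C : k) :
    ∃ x y : k, (x ≠ 0 ∨ y ≠ 0) ∧ A * x ^ 2 + 2 * B * x * y + C * y ^ 2 = 0 := by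
  obtain ⟨p, r, s, t, h1, h2, h3⟩ := s7_bin_factor A B C
  by_cases hp : p = 0 ∧ r = 0
  · refine ⟨1, 0, by simp, ?_⟩
    rw [h1, hp.1]; ring
  · refine ⟨r, -p, ?_, ?_⟩
    · by_contra h
      push Not at h
      exact hp ⟨by simpa using h.2, h.1⟩
    · rw [h1, h2]; linear_combination (-r * p) * h3

theorem s7_tern_aux (hchar : (2 : k) ≠ 0) (A B C D E F w0 w1 w2 : k) (hw : w2 ≠ 0)
    (h0 : A * w0 + D * w1 + E * w2 = 0) (h1 : D * w0 + B * w1 + F * w2 = 0)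
    (h2 : E * w0 + F * w1 + C * w2 = 0) :
    ∃ u0 u1 u2 v0 v1 v2 : k, A = u0 * v0 ∧ B = u1 * v1 ∧ C = u2 * v2 ∧
      2 * D = u0 * v1 + u1 * v0 ∧ 2 * E = u0 * v2 + u2 * v0 ∧ 2 * F = u1 * v2 + u2 * v1 := by
  obtain ⟨p, r, s, t, hA, hB, hD⟩ := s7_bin_factor A D B
  refine ⟨p, r, -(p * w0 + r * w1) / w2, s, t, -(s * w0 + t * w1) / w2, hA, hB, ?_, hD, ?_, ?_⟩
  · field_simp
    linear_combination w2 * h2 - w0 * h0 - w1 * h1 + w0 ^ 2 * hA + w1 ^ 2 * hB + w0 * w1 * hD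
  · field_simp
    linear_combination 2 * h0 - 2 * w0 * hA - w1 * hD
  · field_simp
    linear_combination 2 * h1 - 2 * w1 * hB - w0 * hD

theorem s7_tern_factor (hchar : (2 : k) ≠ 0) (A B C D E F : k)
    (hdet : A * B * C + 2 * D * E * F - A * F ^ 2 - B * E ^ 2 - C * D ^ 2 = 0) :
    ∃ u0 u1 u2 v0 v1 v2 : k, A = u0 * v0 ∧ B = u1 * v1 ∧ C = u2 * v2 ∧
      2 * D = u0 * v1 + u1 * v0 ∧ 2 * E = u0 * v2 + u2 * v0 ∧ 2 * F = u1 * v2 + u2 * v1 := by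
  have hd : (!![A, D, E; D, B, F; E, F, C] : Matrix (Fin 3) (Fin 3) k).det = 0 := by
    rw [Matrix.det_fin_three]; simp; linear_combination hdet
  obtain ⟨w, hw, hw0⟩ := Matrix.exists_mulVec_eq_zero_iff.mpr hd
  have h0 := congrFun hw0 0
  have h1 := congrFun hw0 1
  have h2 := congrFun hw0 2
  simp [Matrix.mulVec, dotProduct, Fin.sum_univ_three] at h0 h1 h2
  by_cases hw2 : w 2 = 0
  · by_cases hw1 : w 1 = 0
    · have hw0' : w 0 ≠ 0 := by
        intro h; apply hw; funext i; fin_cases i <;> simp [h, hw1, hw2]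
      obtain ⟨u0, u1, u2, v0, v1, v2, e1, e2, e3, e4, e5, e6⟩ :=
        s7_tern_aux hchar C B A F E D (w 2) (w 1) (w 0) hw0'
          (by linear_combination h2) (by linear_combination h1) (by linear_combination h0)
      exact ⟨u2, u1, u0, v2, v1, v0, e3, e2, e1, by rw [e6]; ring, by rw [e5]; ring,
        by rw [e4]; ring⟩
    · obtain ⟨u0, u1, u2, v0, v1, v2, e1, e2, e3, e4, e5, e6⟩ :=
        s7_tern_aux hchar A C B E D F (w 0) (w 2) (w 1) hw1
          (by linear_combination h0) (by linear_combination h2) (by linear_combination h1)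
      exact ⟨u0, u2, u1, v0, v2, v1, e1, e3, e2, by rw [e5], by rw [e4], by rw [e6]; ring⟩
  · exact s7_tern_aux hchar A B C D E F (w 0) (w 1) (w 2) hw2 h0 h1 h2

theorem s7_plane (u0 u1 u2 : k) : ∃ p0 p1 p2 q0 q1 q2 : k,
    u0 * p0 + u1 * p1 + u2 * p2 = 0 ∧ u0 * q0 + u1 * q1 + u2 * q2 = 0 ∧
    ∀ s t : k, s * p0 + t * q0 = 0 → s * p1 + t * q1 = 0 → s * p2 + t * q2 = 0 →
      s = 0 ∧ t = 0 := by
  by_cases h0 : u0 = 0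
  · by_cases h1 : u1 = 0
    · exact ⟨1, 0, 0, 0, 1, 0, by simp [h0], by simp [h1], by simp +contextual⟩
    · refine ⟨1, 0, 0, 0, u2, -u1, by simp [h0], by ring, ?_⟩
      intro s t a b c
      simp [h1] at a b c
      exact ⟨a, c⟩
  · refine ⟨u1, -u0, 0, u2, 0, -u0, by ring, by ring, ?_⟩
    intro s t a b c
    simp [h0] at a b c
    exact ⟨b, c⟩

theorem s7_conic_line (A B C D E F u0 u1 u2 : k) : ∃ x y z : k, (x ≠ 0 ∨ y ≠ 0 ∨ z ≠ 0) ∧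
    u0 * x + u1 * y + u2 * z = 0 ∧
    A * x ^ 2 + B * y ^ 2 + C * z ^ 2 + 2 * D * x * y + 2 * E * x * z + 2 * F * y * z = 0 := by
  obtain ⟨p0, p1, p2, q0, q1, q2, hp, hq, hli⟩ := s7_plane u0 u1 u2
  obtain ⟨s, t, hst, h⟩ := s7_bin_zero
    (A * p0 ^ 2 + B * p1 ^ 2 + C * p2 ^ 2 + 2 * D * p0 * p1 + 2 * E * p0 * p2 + 2 * F * p1 * p2)
    (A * p0 * q0 + B * p1 * q1 + C * p2 * q2 + D * (p0 * q1 + p1 * q0) + E * (p0 * q2 + p2 * q0)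
      + F * (p1 * q2 + p2 * q1))
    (A * q0 ^ 2 + B * q1 ^ 2 + C * q2 ^ 2 + 2 * D * q0 * q1 + 2 * E * q0 * q2 + 2 * F * q1 * q2)
  refine ⟨s * p0 + t * q0, s * p1 + t * q1, s * p2 + t * q2, ?_, ?_, ?_⟩
  · by_contra hc
    push Not at hc
    have := hli s t hc.1 hc.2.1 hc.2.2
    rcases hst with h | h
    · exact h this.1
    · exact h this.2
  · linear_combination s * hp + t * hq
  · linear_combination h

theorem s7_conics (hchar : (2 : k) ≠ 0) (A B C D E F A' B' C' D' E' F' : k) :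
    ∃ x y z : k, (x ≠ 0 ∨ y ≠ 0 ∨ z ≠ 0) ∧
    A * x ^ 2 + B * y ^ 2 + C * z ^ 2 + 2 * D * x * y + 2 * E * x * z + 2 * F * y * z = 0 ∧
    A' * x ^ 2 + B' * y ^ 2 + C' * z ^ 2 + 2 * D' * x * y + 2 * E' * x * z + 2 * F' * y * z = 0 := by
  by_cases hd : A' * B' * C' + 2 * D' * E' * F' - A' * F' ^ 2 - B' * E' ^ 2 - C' * D' ^ 2 = 0
  · obtain ⟨u0, u1, u2, v0, v1, v2, e1, e2, e3, e4, e5, e6⟩ := s7_tern_factor hchar _ _ _ _ _ _ hd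
    obtain ⟨x, y, z, hne, hl, hc⟩ := s7_conic_line A B C D E F u0 u1 u2
    refine ⟨x, y, z, hne, hc, ?_⟩
    linear_combination x ^ 2 * e1 + y ^ 2 * e2 + z ^ 2 * e3 + x * y * e4 + x * z * e5 + y * z * e6
      + (v0 * x + v1 * y + v2 * z) * hl
  · obtain ⟨l, hl⟩ := s7_cubic_root
      (A' * B' * C' + 2 * D' * E' * F' - A' * F' ^ 2 - B' * E' ^ 2 - C' * D' ^ 2)
      (A * B' * C' + A' * B * C' + A' * B' * C + 2 * (D * E' * F' + D' * E * F' + D' * E' * F)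
        - (A * F' ^ 2 + 2 * A' * F * F') - (B * E' ^ 2 + 2 * B' * E * E')
        - (C * D' ^ 2 + 2 * C' * D * D'))
      (A * B * C' + A * B' * C + A' * B * C + 2 * (D * E * F' + D * E' * F + D' * E * F)
        - (A' * F ^ 2 + 2 * A * F * F') - (B' * E ^ 2 + 2 * B * E * E')
        - (C' * D ^ 2 + 2 * C * D * D'))
      (A * B * C + 2 * D * E * F - A * F ^ 2 - B * E ^ 2 - C * D ^ 2) hd
    obtain ⟨u0, u1, u2, v0, v1, v2, e1, e2, e3, e4, e5, e6⟩ :=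
      s7_tern_factor hchar (A + l * A') (B + l * B') (C + l * C') (D + l * D') (E + l * E')
        (F + l * F') (by linear_combination hl)
    obtain ⟨x, y, z, hne, hl, hc⟩ := s7_conic_line A' B' C' D' E' F' u0 u1 u2
    refine ⟨x, y, z, hne, ?_, hc⟩
    linear_combination x ^ 2 * e1 + y ^ 2 * e2 + z ^ 2 * e3 + x * y * e4 + x * z * e5 + y * z * e6
      + (v0 * x + v1 * y + v2 * z) * hl - l * hc

/-- proportional-case of unique factorization of binary forms -/
theorem s7_ufd_aux (p r s t p' r' s' t' : k) (hA : p * s = p' * s') (hC : r * t = r' * t')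
    (hB : p * t + r * s = p' * t' + r' * s')
    (hne : p * s ≠ 0 ∨ r * t ≠ 0 ∨ p * t + r * s ≠ 0) (h : p * r' = r * p') :
    ∃ c : k, c ≠ 0 ∧ p' = c * p ∧ r' = c * r ∧ s = c * s' ∧ t = c * t' := by
  by_cases hp : p = 0
  · have hr : r ≠ 0 := by
      rintro rfl; simp [hp] at hne
    have hp' : p' = 0 := by
      simpa [hp, hr] using h.symm
    subst hp hp'
    have hr' : r' ≠ 0 := by
      rintro rfl
      rcases hne with h | h | h
      · simp at h
      · apply h; linear_combination hC
      · apply h; linear_combination hB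
    refine ⟨r' / r, div_ne_zero hr' hr, by simp, by field_simp, ?_, ?_⟩
    · field_simp; linear_combination hB
    · field_simp; linear_combination hC
  · have hp' : p' ≠ 0 := by
      rintro rfl
      have hr' : r' = 0 := by simpa [hp] using h
      subst hr'
      simp at hA hB hC
      rcases hne with h | h | h
      · simp [hp] at hA; simp [hA] at h
      · rcases hC with h1 | h1 <;> simp [h1] at h
      · exact h hB
    refine ⟨p' / p, div_ne_zero hp' hp, by field_simp, ?_, ?_, ?_⟩
    · field_simp; linear_combination h
    · field_simp; linear_combination hA
    · have hs : s = p' / p * s' := by field_simp; linear_combination hA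
      field_simp
      have : p * (p * t - p' * t') = 0 := by
        rw [hs] at hB
        field_simp at hB
        linear_combination hB + s' * h
      rcases mul_eq_zero.mp this with h1 | h1
      · exact absurd h1 hp
      · linear_combination h1

theorem s7_ufd (p r s t p' r' s' t' : k) (hA : p * s = p' * s') (hC : r * t = r' * t')
    (hB : p * t + r * s = p' * t' + r' * s')
    (hne : p * s ≠ 0 ∨ r * t ≠ 0 ∨ p * t + r * s ≠ 0) :
    (∃ c : k, c ≠ 0 ∧ p' = c * p ∧ r' = c * r ∧ s = c * s' ∧ t = c * t') ∨
    (∃ c : k, c ≠ 0 ∧ p' = c * s ∧ r' = c * t ∧ p = c * s' ∧ r = c * t') := by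
  have key : (p * r' - r * p') * (s * r' - t * p') = 0 := by
    linear_combination r' ^ 2 * hA + p' ^ 2 * hC - r' * p' * hB
  rcases mul_eq_zero.mp key with h | h
  · exact Or.inl (s7_ufd_aux p r s t p' r' s' t' hA hC hB hne (by linear_combination h))
  · refine Or.inr (s7_ufd_aux s t p r p' r' s' t' (by linear_combination hA)
      (by linear_combination hC) (by linear_combination hB) ?_ (by linear_combination h))
    rcases hne with h | h | h
    · left; rwa [mul_comm]
    · right; left; rwa [mul_comm]
    · right; right; intro h'; apply h; linear_combination h'

end Scalars

section Core
variable {k : Type*} [Field k]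

def s7_M (k : Type*) [Field k] : Matrix (Fin 4) (Fin 4) k :=
  !![0, 1, 0, 0; 1, 0, 0, 0; 0, 0, 0, 0; 0, 0, 0, 0]

def s7_form (t : Matrix (Fin 4) (Fin 4) k) (x : Fin 4 → k) : k :=
  ∑ i, ∑ j, x i * x j * t i j

theorem s7_minor3 (t : Matrix (Fin 4) (Fin 4) k) (h : t.rank ≤ 2) (r c : Fin 3 → Fin 4) :
    (t.submatrix r c).det = 0 := by
  by_contra hd
  have h1 := Matrix.rank_of_isUnit (t.submatrix r c)
    ((Matrix.isUnit_iff_isUnit_det _).mpr (isUnit_iff_ne_zero.mpr hd))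
  have h2 := Matrix.rank_submatrix_le t r c
  rw [Fintype.card_fin] at h1
  omega

theorem s7_minor2 (t : Matrix (Fin 4) (Fin 4) k) (h : t.rank ≤ 1) (i i' j j' : Fin 4) :
    t i j * t i' j' = t i j' * t i' j := by
  by_contra hd
  have h1 := Matrix.rank_of_isUnit (t.submatrix ![i, i'] ![j, j'])
    ((Matrix.isUnit_iff_isUnit_det _).mpr (isUnit_iff_ne_zero.mpr (by
      rw [Matrix.det_fin_two]; simpa [sub_eq_zero] using hd)))
  have h2 := Matrix.rank_submatrix_le t ![i, i'] ![j, j']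
  rw [Fintype.card_fin] at h1
  omega

theorem s7_rank_zero (t : Matrix (Fin 4) (Fin 4) k) (h : t.rank = 0) : t = 0 := by
  rw [Matrix.rank, Submodule.finrank_eq_zero, LinearMap.range_eq_bot] at h
  ext i j
  have := congrFun (LinearMap.congr_fun h (Pi.single j 1)) i
  simpa using this

/-- The 3×3 minor with rows 0,1,i and columns 0,1,j. -/
theorem s7_minor01 (t : Matrix (Fin 4) (Fin 4) k) (l : k) (h : (t + l • s7_M k).rank ≤ 2)
    (hs : t.IsSymm) (i j : Fin 4) (hi : i = 2 ∨ i = 3) (hj : j = 2 ∨ j = 3) :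
    (-t i j) * (t 0 1 + l) ^ 2 + (t 1 j * t 0 i + t 0 j * t 1 i) * (t 0 1 + l)
      + (t 0 0 * t 1 1 * t i j - t 0 0 * t 1 j * t 1 i - t 1 1 * t 0 j * t 0 i) = 0 := by
  have := s7_minor3 _ h ![0, 1, i] ![0, 1, j]
  rw [Matrix.det_fin_three] at this
  have e1 := hs.apply 0 1
  have e2 := hs.apply 0 i
  have e3 := hs.apply 1 i
  rcases hi with rfl | rfl <;> rcases hj with rfl | rfl <;>
  · simp [s7_M, e1, e2, e3] at this
    linear_combination this

theorem s7_two_roots [IsAlgClosed k] (A B C : k) (h : A ≠ 0 ∨ B ≠ 0) :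
    ∃ x y : k, ∀ m : k, A * m ^ 2 + B * m + C = 0 → m = x ∨ m = y := by
  by_cases hA : A = 0
  · have hB : B ≠ 0 := by tauto
    refine ⟨-C / B, 0, fun m hm => Or.inl ?_⟩
    field_simp
    rw [hA] at hm
    linear_combination hm
  · obtain ⟨x, hx⟩ := s7_quad_root A B C hA
    refine ⟨x, -B / A - x, fun m hm => ?_⟩
    have : (m - x) * (A * (m + x) + B) = 0 := by linear_combination hm - hx
    rcases mul_eq_zero.mp this with h | h
    · left; linear_combination h
    · right; field_simp; linear_combination h

variable {E : Type*} [AddCommGroup E] [Module k E]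

theorem s7_ext2 (V : Submodule k E) (hV : Module.finrank k V = 3) (q q' : E) (hq : q ∈ V)
    (hq' : q' ∈ V) (hli : LinearIndependent k ![q, q']) :
    ∃ q2 ∈ V, ∀ p ∈ V, ∃ c d f : k, p = c • q + d • q' + f • q2 := by
  have hfin : FiniteDimensional k V := Module.finite_of_finrank_pos (by omega)
  have hlt : ∃ q2 ∈ V, q2 ∉ Submodule.span k {q, q'} := by
    by_contra hc
    push Not at hc
    have h1 : V ≤ Submodule.span k {q, q'} := hc
    have h2 : Module.finrank k V ≤ Module.finrank k (Submodule.span k {q, q'}) := by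
      have : FiniteDimensional k (Submodule.span k {q, q'}) :=
        FiniteDimensional.span_of_finite k (by simp)
      exact Submodule.finrank_mono h1
    have h3 : Module.finrank k (Submodule.span k {q, q'}) ≤ 2 := by
      have := finrank_range_le_card (R := k) ![q, q']
      have e : Set.range ![q, q'] = {q, q'} := by simp [Set.pair_comm]
      rw [e] at this
      simpa [Set.finrank] using this
    omega
  obtain ⟨q2, hq2, hn⟩ := hlt
  refine ⟨q2, hq2, ?_⟩
  have hli3 : LinearIndependent k ![q2, q, q'] := by
    rw [linearIndependent_finSucc]
    refine ⟨by simpa [Fin.tail] using hli, ?_⟩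
    have : Set.range (Fin.tail ![q2, q, q']) = {q, q'} := by
      have : Fin.tail ![q2, q, q'] = ![q, q'] := rfl
      rw [this]; simp [Set.pair_comm]
    rw [this]; simpa using hn
  have hsp : Submodule.span k (Set.range ![q2, q, q']) = V := by
    apply Submodule.eq_of_le_of_finrank_eq
    · rw [Submodule.span_le]
      rintro _ ⟨i, rfl⟩
      fin_cases i <;> simp [hq, hq', hq2]
    · rw [finrank_span_eq_card hli3, hV]; simp
  intro p hp
  rw [← hsp] at hp
  have : Set.range ![q2, q, q'] = {q2, q, q'} := by
    ext z; simp; tauto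
  rw [this, Submodule.mem_span_triple] at hp
  obtain ⟨a, b, c, h⟩ := hp
  exact ⟨b, c, a, by rw [← h]; abel⟩

theorem s7_ext1 (V : Submodule k E) (hV : Module.finrank k V = 3) (q : E) (hq : q ∈ V)
    (hq0 : q ≠ 0) :
    ∃ q1 ∈ V, ∃ q2 ∈ V, ∀ p ∈ V, ∃ c d f : k, p = c • q + d • q1 + f • q2 := by
  have hlt : ∃ q1 ∈ V, q1 ∉ Submodule.span k {q} := by
    by_contra hc
    push Not at hc
    have h1 : V ≤ Submodule.span k {q} := hc
    have h2 : Module.finrank k V ≤ Module.finrank k (Submodule.span k {q}) :=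
      Submodule.finrank_mono h1
    rw [finrank_span_singleton hq0] at h2
    omega
  obtain ⟨q1, hq1, hn⟩ := hlt
  have hli : LinearIndependent k ![q, q1] := by
    rw [LinearIndependent.pair_iff' hq0]
    intro a ha
    exact hn (Submodule.mem_span_singleton.mpr ⟨a, ha⟩)
  obtain ⟨q2, hq2, h⟩ := s7_ext2 V hV q q1 hq hq1 hli
  exact ⟨q1, hq1, q2, hq2, h⟩

theorem s7_form_comb (T : E →ₗ[k] Matrix (Fin 4) (Fin 4) k) (c d f : k) (p q r : E)
    (x : Fin 4 → k) : s7_form (T (c • p + d • q + f • r)) x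
      = c * s7_form (T p) x + d * s7_form (T q) x + f * s7_form (T r) x := by
  simp only [s7_form, Finset.mul_sum, ← Finset.sum_add_distrib]
  refine Finset.sum_congr rfl fun i _ => Finset.sum_congr rfl fun j _ => ?_
  simp; ring

variable [IsAlgClosed k] (hchar : (2 : k) ≠ 0) (T : E →ₗ[k] Matrix (Fin 4) (Fin 4) k)
  (hsymm : ∀ p, (T p).IsSymm) (V : Submodule k E) (hV : Module.finrank k V = 3)
  (hbpf : ∀ x : Fin 4 → k, x 0 * x 1 = 0 → (∀ p ∈ V, s7_form (T p) x = 0) → x = 0)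

include hchar hsymm hV hbpf

theorem s7_noB (q : E) (hq : q ∈ V) (hq0 : q ≠ 0) (h00 : T q 0 0 = 0) (h22 : T q 2 2 = 0)
    (h33 : T q 3 3 = 0) (h02 : T q 0 2 = 0) (h03 : T q 0 3 = 0) (h23 : T q 2 3 = 0) : False := by
  obtain ⟨q1, hq1, q2, hq2, hsp⟩ := s7_ext1 V hV q hq hq0
  obtain ⟨x, y, z, hne, h1, h2⟩ := s7_conics hchar
    (T q1 0 0) (T q1 2 2) (T q1 3 3) (T q1 0 2) (T q1 0 3) (T q1 2 3)
    (T q2 0 0) (T q2 2 2) (T q2 3 3) (T q2 0 2) (T q2 0 3) (T q2 2 3)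
  have hform : ∀ p, s7_form (T p) ![x, 0, y, z] = T p 0 0 * x ^ 2 + T p 2 2 * y ^ 2
      + T p 3 3 * z ^ 2 + 2 * T p 0 2 * x * y + 2 * T p 0 3 * x * z + 2 * T p 2 3 * y * z := by
    intro p
    have e1 := (hsymm p).apply 0 2
    have e2 := (hsymm p).apply 0 3
    have e3 := (hsymm p).apply 2 3
    simp [s7_form, Fin.sum_univ_four, e1, e2, e3]; ring
  have := hbpf ![x, 0, y, z] (by simp) (by
    intro p hp
    obtain ⟨c, d, f, rfl⟩ := hsp p hp
    rw [s7_form_comb, hform q, hform q1, hform q2, h1, h2, h00, h22, h33, h02, h03, h23]; ring)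
  have e0 := congrFun this 0
  have e2 := congrFun this 2
  have e3 := congrFun this 3
  simp at e0 e2 e3
  tauto

theorem s7_noA (q : E) (hq : q ∈ V) (hq0 : q ≠ 0) (h11 : T q 1 1 = 0) (h22 : T q 2 2 = 0)
    (h33 : T q 3 3 = 0) (h12 : T q 1 2 = 0) (h13 : T q 1 3 = 0) (h23 : T q 2 3 = 0) : False := by
  obtain ⟨q1, hq1, q2, hq2, hsp⟩ := s7_ext1 V hV q hq hq0
  obtain ⟨x, y, z, hne, h1, h2⟩ := s7_conics hchar
    (T q1 1 1) (T q1 2 2) (T q1 3 3) (T q1 1 2) (T q1 1 3) (T q1 2 3)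
    (T q2 1 1) (T q2 2 2) (T q2 3 3) (T q2 1 2) (T q2 1 3) (T q2 2 3)
  have hform : ∀ p, s7_form (T p) ![0, x, y, z] = T p 1 1 * x ^ 2 + T p 2 2 * y ^ 2
      + T p 3 3 * z ^ 2 + 2 * T p 1 2 * x * y + 2 * T p 1 3 * x * z + 2 * T p 2 3 * y * z := by
    intro p
    have e1 := (hsymm p).apply 1 2
    have e2 := (hsymm p).apply 1 3
    have e3 := (hsymm p).apply 2 3
    simp [s7_form, Fin.sum_univ_four, e1, e2, e3]; ring
  have := hbpf ![0, x, y, z] (by simp) (by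
    intro p hp
    obtain ⟨c, d, f, rfl⟩ := hsp p hp
    rw [s7_form_comb, hform q, hform q1, hform q2, h1, h2, h11, h22, h33, h12, h13, h23]; ring)
  have e0 := congrFun this 1
  have e2 := congrFun this 2
  have e3 := congrFun this 3
  simp at e0 e2 e3
  tauto

theorem s7_noU (q q' : E) (hq : q ∈ V) (hq' : q' ∈ V) (hli : LinearIndependent k ![q, q'])
    (h22 : T q 2 2 = 0) (h33 : T q 3 3 = 0) (h23 : T q 2 3 = 0)
    (h22' : T q' 2 2 = 0) (h33' : T q' 3 3 = 0) (h23' : T q' 2 3 = 0) : False := by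
  obtain ⟨q2, hq2, hsp⟩ := s7_ext2 V hV q q' hq hq' hli
  obtain ⟨y, z, hne, h1⟩ := s7_bin_zero (T q2 2 2) (T q2 2 3) (T q2 3 3)
  have hform : ∀ p, s7_form (T p) ![0, 0, y, z] = T p 2 2 * y ^ 2
      + 2 * T p 2 3 * y * z + T p 3 3 * z ^ 2 := by
    intro p
    have e3 := (hsymm p).apply 2 3
    simp [s7_form, Fin.sum_univ_four, e3]; ring
  have := hbpf ![0, 0, y, z] (by simp) (by
    intro p hp
    obtain ⟨c, d, f, rfl⟩ := hsp p hp
    rw [s7_form_comb, hform q, hform q', hform q2, h1, h22, h33, h23, h22', h33', h23']; ring)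
  have e2 := congrFun this 2
  have e3 := congrFun this 3
  simp at e2 e3
  tauto

variable (hr1 : ∀ q ∈ V, q ≠ 0 → ∀ l m : k, (T q + l • s7_M k).rank = 1 →
  (T q + m • s7_M k).rank = 1 → l = m)

include hr1

theorem s7_noE (q : E) (hq : q ∈ V) (hq0 : q ≠ 0) (h22 : T q 2 2 = 0)
    (h33 : T q 3 3 = 0) (h02 : T q 0 2 = 0) (h03 : T q 0 3 = 0) (h23 : T q 2 3 = 0)
    (h12 : T q 1 2 = 0) (h13 : T q 1 3 = 0) : False := by
  by_cases h00 : T q 0 0 = 0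
  · exact s7_noB hchar T hsymm V hV hbpf q hq hq0 h00 h22 h33 h02 h03 h23
  by_cases h11 : T q 1 1 = 0
  · exact s7_noA hchar T hsymm V hV hbpf q hq hq0 h11 h22 h33 h12 h13 h23
  obtain ⟨s, hs⟩ := IsAlgClosed.exists_pow_nat_eq (T q 0 0 * T q 1 1) (n := 2) (by norm_num)
  have key : ∀ s : k, s ^ 2 = T q 0 0 * T q 1 1 →
      (T q + (s - T q 0 1) • s7_M k).rank = 1 := by
    intro s hs
    have e01 := (hsymm q).apply 0 1
    have e02 := (hsymm q).apply 0 2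
    have e03 := (hsymm q).apply 0 3
    have e12 := (hsymm q).apply 1 2
    have e13 := (hsymm q).apply 1 3
    have e23 := (hsymm q).apply 2 3
    have heq : T q + (s - T q 0 1) • s7_M k
        = Matrix.vecMulVec ![T q 0 0, s, 0, 0] ![1, s / T q 0 0, 0, 0] := by
      ext i j
      fin_cases i <;> fin_cases j <;>
        simp [s7_M, Matrix.vecMulVec, h22, h33, h02, h03, h23, h12, h13, e01, e02, e03, e12,
          e13, e23] <;> field_simp
      linear_combination -hs
    apply le_antisymm
    · rw [heq]; exact Matrix.rank_vecMulVec_le _ _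
    · rw [Nat.one_le_iff_ne_zero]
      intro h0
      have h0 := s7_rank_zero _ h0
      have := congrFun (congrFun h0 0) 0
      simp [s7_M, h00] at this
  have := hr1 q hq hq0 _ _ (key s hs) (key (-s) (by rw [neg_sq, hs]))
  have h2 : 2 * s = 0 := by linear_combination this
  have : s = 0 := by simpa [hchar] using h2
  rw [this] at hs
  have : T q 0 0 * T q 1 1 = 0 := by rw [← hs]; simp
  simp [h00, h11] at this

theorem s7_B (q : E) (hq : q ∈ V) (hq0 : q ≠ 0) :
    ∃ x y : k, ∀ l : k, (T q + l • s7_M k).rank ≤ 2 → l = x ∨ l = y := by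
  by_cases hex : ∃ l : k, (T q + l • s7_M k).rank ≤ 2
  swap
  · exact ⟨0, 0, fun l hl => absurd ⟨l, hl⟩ hex⟩
  have step : ∀ i j : Fin 4, (i = 2 ∨ i = 3) → (j = 2 ∨ j = 3) →
      (-T q i j ≠ 0 ∨ T q 1 j * T q 0 i + T q 0 j * T q 1 i ≠ 0) →
      ∃ x y : k, ∀ l : k, (T q + l • s7_M k).rank ≤ 2 → l = x ∨ l = y := by
    intro i j hi hj hne
    obtain ⟨x, y, hxy⟩ := s7_two_roots _ _
      (T q 0 0 * T q 1 1 * T q i j - T q 0 0 * T q 1 j * T q 1 i - T q 1 1 * T q 0 j * T q 0 i) hne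
    refine ⟨x - T q 0 1, y - T q 0 1, fun l hl => ?_⟩
    rcases hxy _ (s7_minor01 (T q) l hl (hsymm q) i j hi hj) with h | h
    · left; linear_combination h
    · right; linear_combination h
  by_contra hcon
  have c22 := mt (step 2 2 (by simp) (by simp)) hcon
  have c33 := mt (step 3 3 (by simp) (by simp)) hcon
  have c23 := mt (step 2 3 (by simp) (by simp)) hcon
  push Not at c22 c33 c23
  obtain ⟨l, hl⟩ := hex
  have m22 := s7_minor01 (T q) l hl (hsymm q) 2 2 (by simp) (by simp)
  have m33 := s7_minor01 (T q) l hl (hsymm q) 3 3 (by simp) (by simp)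
  have d2 := s7_minor3 _ hl ![0, 1, 2] ![0, 2, 3]
  have d3 := s7_minor3 _ hl ![0, 1, 3] ![0, 2, 3]
  obtain ⟨h22, f22⟩ := c22
  obtain ⟨h33, f33⟩ := c33
  obtain ⟨h23, f23⟩ := c23
  rw [neg_eq_zero] at h22 h33 h23
  have e01 := (hsymm q).apply 0 1
  have e02 := (hsymm q).apply 0 2
  have e03 := (hsymm q).apply 0 3
  have e12 := (hsymm q).apply 1 2
  have e13 := (hsymm q).apply 1 3
  have e23 := (hsymm q).apply 2 3
  rw [Matrix.det_fin_three] at d2 d3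
  simp [s7_M, h22, h33, h23, e01, e02, e03, e12, e13, e23] at d2 d3
  rw [h22, f22] at m22
  rw [h33, f33] at m33
  have g2 : T q 0 2 * T q 1 2 = 0 := by
    have : 2 * (T q 0 2 * T q 1 2) = 0 := by linear_combination f22
    simpa [hchar] using this
  have g3 : T q 0 3 * T q 1 3 = 0 := by
    have : 2 * (T q 0 3 * T q 1 3) = 0 := by linear_combination f33
    simpa [hchar] using this
  have hdel : T q 0 2 * T q 1 3 - T q 0 3 * T q 1 2 = 0 := by
    have : (T q 0 2 * T q 1 3 - T q 0 3 * T q 1 2) ^ 2 = 0 := by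
      linear_combination (T q 1 3) * d2 - T q 1 2 * d3
    exact pow_eq_zero_iff (two_ne_zero) |>.mp this
  have g23 : T q 0 2 * T q 1 3 = 0 := by
    have : 2 * (T q 0 2 * T q 1 3) = 0 := by linear_combination f23 + hdel
    simpa [hchar] using this
  have g32 : T q 0 3 * T q 1 2 = 0 := by linear_combination g23 - hdel
  have hrow : (T q 0 2 = 0 ∧ T q 0 3 = 0) ∨ (T q 1 2 = 0 ∧ T q 1 3 = 0) := by
    simp only [mul_eq_zero] at g2 g3 g23 g32
    tauto
  rcases hrow with ⟨h02, h03⟩ | ⟨h12, h13⟩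
  · by_cases h00 : T q 0 0 = 0
    · exact s7_noB hchar T hsymm V hV hbpf q hq hq0 h00 h22 h33 h02 h03 h23
    · refine s7_noE hchar T hsymm V hV hbpf hr1 q hq hq0 h22 h33 h02 h03 h23 ?_ ?_
      · simpa [h02, h00] using m22
      · simpa [h03, h00] using m33
  · by_cases h11 : T q 1 1 = 0
    · exact s7_noA hchar T hsymm V hV hbpf q hq hq0 h11 h22 h33 h12 h13 h23
    · refine s7_noE hchar T hsymm V hV hbpf hr1 q hq hq0 h22 h33 ?_ ?_ h23 h12 h13
      · simpa [h12, h11] using m22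
      · simpa [h13, h11] using m33

theorem s7_C (q : E) (hq : q ∈ V) (hq0 : q ≠ 0) (l m : k) (hl : (T q + l • s7_M k).rank = 1)
    (hm : (T q + m • s7_M k).rank ≤ 2) : m = l := by
  by_contra hne
  have e01 := (hsymm q).apply 0 1
  have e02 := (hsymm q).apply 0 2
  have e03 := (hsymm q).apply 0 3
  have e12 := (hsymm q).apply 1 2
  have e13 := (hsymm q).apply 1 3
  have e23 := (hsymm q).apply 2 3
  have mm := s7_minor2 _ hl.le
  have step : ∀ i : Fin 4, (i = 2 ∨ i = 3) → T q i i = 0 ∧ T q 0 i = 0 ∧ T q 1 i = 0 := by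
    intro i hi
    have m1 := s7_minor01 (T q) m hm (hsymm q) i i hi hi
    have a1 := mm 0 i 1 i
    have a2 := mm 0 1 0 i
    have a3 := mm 0 1 1 i
    have a4 := mm 0 i 0 i
    have a5 := mm 1 i 1 i
    have a6 := mm 0 1 0 1
    rcases hi with rfl | rfl
    all_goals
      simp [s7_M, e01, e02, e03, e12, e13] at a1 a2 a3 a4 a5 a6
    · have z : (m - l) ^ 2 * T q 2 2 = 0 := by
        linear_combination -m1 - 2 * (m - l) * a1 - T q 1 2 * a2 + T q 2 2 * a6
          + T q 0 2 * a3
      have z2 : T q 2 2 = 0 := by simpa [sub_eq_zero, hne] using z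
      rw [z2] at a4 a5
      exact ⟨z2, by simpa using a4.symm, by simpa using a5.symm⟩
    · have z : (m - l) ^ 2 * T q 3 3 = 0 := by
        linear_combination -m1 - 2 * (m - l) * a1 - T q 1 3 * a2 + T q 3 3 * a6
          + T q 0 3 * a3
      have z2 : T q 3 3 = 0 := by simpa [sub_eq_zero, hne] using z
      rw [z2] at a4 a5
      exact ⟨z2, by simpa using a4.symm, by simpa using a5.symm⟩
  obtain ⟨h22, h02, h12⟩ := step 2 (by simp)
  obtain ⟨h33, h03, h13⟩ := step 3 (by simp)
  have h23 : T q 2 3 = 0 := by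
    have := mm 2 3 2 3
    simp [s7_M, h22, h33, e23] at this
    exact this
  exact s7_noE hchar T hsymm V hV hbpf hr1 q hq hq0 h22 h33 h02 h03 h23 h12 h13

end Core

section CoreD
variable {k : Type*} [Field k] [IsAlgClosed k] (hchar : (2 : k) ≠ 0)
include hchar

theorem s7_D (t : Matrix (Fin 4) (Fin 4) k) (hs : t.IsSymm)
    (ha : (t.submatrix ![1, 2, 3] ![1, 2, 3]).det = 0)
    (hb : (t.submatrix ![0, 2, 3] ![0, 2, 3]).det = 0)
    (hne : ¬ (t 2 2 = 0 ∧ t 3 3 = 0 ∧ t 2 3 = 0)) :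
    ∃ l : k, (t + l • s7_M k).rank ≤ 2 := by
  have e01 := hs.apply 0 1
  have e02 := hs.apply 0 2
  have e03 := hs.apply 0 3
  have e12 := hs.apply 1 2
  have e13 := hs.apply 1 3
  have e23 := hs.apply 2 3
  rw [Matrix.det_fin_three] at ha hb
  simp [e01, e02, e03, e12, e13, e23] at ha hb
  obtain ⟨u1, u2, u3, v1, v2, v3, a1, a2, a3, a4, a5, a6⟩ :=
    s7_tern_factor hchar (t 1 1) (t 2 2) (t 3 3) (t 1 2) (t 1 3) (t 2 3)
      (by linear_combination ha)
  obtain ⟨w0, w2, w3, z0, z2, z3, b1, b2, b3, b4, b5, b6⟩ :=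
    s7_tern_factor hchar (t 0 0) (t 2 2) (t 3 3) (t 0 2) (t 0 3) (t 2 3)
      (by linear_combination hb)
  have fin : ∀ L R : Fin 4 → k, 2 * t 0 0 = L 0 * R 0 + R 0 * L 0 →
      2 * t 1 1 = L 1 * R 1 + R 1 * L 1 →
      2 * t 2 2 = L 2 * R 2 + R 2 * L 2 → 2 * t 3 3 = L 3 * R 3 + R 3 * L 3 →
      2 * t 0 2 = L 0 * R 2 + R 0 * L 2 → 2 * t 0 3 = L 0 * R 3 + R 0 * L 3 →
      2 * t 1 2 = L 1 * R 2 + R 1 * L 2 → 2 * t 1 3 = L 1 * R 3 + R 1 * L 3 →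
      2 * t 2 3 = L 2 * R 3 + R 2 * L 3 → ∃ l : k, (t + l • s7_M k).rank ≤ 2 := by
    intro L R f00 f11 f22 f33 f02 f03 f12 f13 f23
    refine ⟨(L 0 * R 1 + R 0 * L 1) / 2 - t 0 1, ?_⟩
    have heq : t + ((L 0 * R 1 + R 0 * L 1) / 2 - t 0 1) • s7_M k
        = (Matrix.of fun (i : Fin 4) (j : Fin 2) => (![L i, R i] j) / 2)
          * (Matrix.of fun (i : Fin 2) (j : Fin 4) => ![R j, L j] i) := by
      ext i j
      rw [Matrix.mul_apply, Fin.sum_univ_two]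
      fin_cases i <;> fin_cases j <;>
        simp [s7_M, e01, e02, e03, e12, e13, e23] <;> field_simp <;>
        first
        | (ring; done)
        | linear_combination f00
        | linear_combination f11
        | linear_combination f22
        | linear_combination f33
        | linear_combination f02
        | linear_combination f03
        | linear_combination f12
        | linear_combination f13
        | linear_combination f23
    rw [heq]
    refine (Matrix.rank_mul_le_left _ _).trans ?_
    simpa using Matrix.rank_le_width
      (Matrix.of fun (i : Fin 4) (j : Fin 2) => (![L i, R i] j) / 2)
  have hne' : u2 * v2 ≠ 0 ∨ u3 * v3 ≠ 0 ∨ u2 * v3 + u3 * v2 ≠ 0 := by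
    by_contra hc
    push Not at hc
    apply hne
    refine ⟨by rw [a2, hc.1], by rw [a3, hc.2.1], ?_⟩
    have : 2 * t 2 3 = 0 := by rw [a6, hc.2.2]
    simpa [hchar] using this
  rcases s7_ufd u2 u3 v2 v3 w2 w3 z2 z3 (by rw [← a2, b2]) (by rw [← a3, b3])
    (by rw [← a6, b6]) hne' with ⟨c, hc, r1, r2, r3, r4⟩ | ⟨c, hc, r1, r2, r3, r4⟩
  · subst r1 r2 r3 r4
    refine fin ![w0 / c, u1, u2, u3] ![c * z0, v1, c * z2, c * z3] ?_ ?_ ?_ ?_ ?_ ?_ ?_ ?_ ?_ <;>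
      simp <;> field_simp
    · linear_combination 2 * b1
    · linear_combination 2 * a1
    · linear_combination 2 * a2
    · linear_combination 2 * a3
    · linear_combination b4
    · linear_combination b5
    · linear_combination a4
    · linear_combination a5
    · linear_combination a6
  · subst r1 r2 r3 r4
    refine fin ![w0 / c, v1, v2, v3] ![c * z0, u1, c * z2, c * z3] ?_ ?_ ?_ ?_ ?_ ?_ ?_ ?_ ?_ <;>
      simp <;> field_simp
    · linear_combination 2 * b1
    · linear_combination 2 * a1
    · linear_combination 2 * a2
    · linear_combination 2 * a3
    · linear_combination b4
    · linear_combination b5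
    · linear_combination a4
    · linear_combination a5
    · linear_combination a6

end CoreD

section Count
variable {k : Type*} [Field k] {E : Type*} [AddCommGroup E] [Module k E]

theorem s7_uniq (V : Submodule k E) (e : E) (he : e ∉ V) (q q' : E) (hq : q ∈ V) (hq' : q' ∈ V)
    (x y c : k) (h : q + x • e = c • (q' + y • e)) : q = c • q' ∧ x = c * y := by
  have h1 : (x - c * y) • e = c • q' - q := by
    rw [sub_smul, mul_smul]
    rw [smul_add] at h
    rw [sub_eq_sub_iff_add_eq_add, add_comm, h]
  have h2 : x - c * y = 0 := by
    by_contra hne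
    apply he
    have : e = (x - c * y)⁻¹ • (c • q' - q) := by rw [← h1, smul_smul, inv_mul_cancel₀ hne, one_smul]
    rw [this]
    exact V.smul_mem _ (V.sub_mem (V.smul_mem _ hq') hq)
  rw [h2, zero_smul] at h1
  exact ⟨(sub_eq_zero.mp h1.symm).symm, sub_eq_zero.mp h2⟩

theorem s7_span_smul (c : k) (hc : c ≠ 0) (p : E) :
    Submodule.span k {c • p} = Submodule.span k {p} :=
  Submodule.span_singleton_smul_eq (IsUnit.mk0 c hc) p

theorem s7_span_eq {p q : E} (hp : p ≠ 0) (h : Submodule.span k {p} = Submodule.span k {q}) :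
    ∃ c : k, c ≠ 0 ∧ p = c • q := by
  have : p ∈ Submodule.span k {q} := h ▸ Submodule.mem_span_singleton_self p
  obtain ⟨c, hc⟩ := Submodule.mem_span_singleton.mp this
  refine ⟨c, ?_, hc.symm⟩
  rintro rfl
  simp at hc
  exact hp hc.symm

theorem s7_count (V Q : Submodule k E) (e : E) (he : e ∉ V) (hQ : Q = Submodule.span k {e} ⊔ V)
    (F R1 R2 : E → Prop) (he2 : R2 e)
    (hs1 : ∀ c : k, c ≠ 0 → ∀ p ∈ Q, R1 p → R1 (c • p))
    (hs2 : ∀ c : k, c ≠ 0 → ∀ p ∈ Q, R2 p → R2 (c • p))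
    (hx : ∀ p ∈ Q, R1 p → ¬ R2 p)
    (hA : ∀ q ∈ V, q ≠ 0 → ∀ x : k, (R1 (q + x • e) ∨ R2 (q + x • e)) → F q)
    (hB : ∀ q ∈ V, q ≠ 0 → ∃ x y : k, ∀ l : k, R2 (q + l • e) → l = x ∨ l = y)
    (hC : ∀ q ∈ V, q ≠ 0 → ∀ l m : k, R1 (q + l • e) → R2 (q + m • e) → False)
    (hD : ∀ q ∈ V, q ≠ 0 → ∀ q' ∈ V, q' ≠ 0 → F q → F q' →
      (¬ ∃ l : k, R1 (q + l • e) ∨ R2 (q + l • e)) →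
      (¬ ∃ l : k, R1 (q' + l • e) ∨ R2 (q' + l • e)) →
      Submodule.span k {q} = Submodule.span k {q'})
    (hF : {W : Submodule k E | ∃ q ∈ V, q ≠ 0 ∧ W = Submodule.span k {q} ∧ F q}.Finite)
    (hS1 : {W : Submodule k E | ∃ q ∈ Q, q ≠ 0 ∧ W = Submodule.span k {q} ∧ R1 q}.Subsingleton) :
    {W : Submodule k E | ∃ q ∈ V, q ≠ 0 ∧ W = Submodule.span k {q} ∧ F q}.ncard
        - {W : Submodule k E | ∃ q ∈ Q, q ≠ 0 ∧ W = Submodule.span k {q} ∧ R1 q}.ncard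
      ≤ {W : Submodule k E | ∃ q ∈ Q, q ≠ 0 ∧ W = Submodule.span k {q} ∧ R2 q}.ncard ∧
    {W : Submodule k E | ∃ q ∈ Q, q ≠ 0 ∧ W = Submodule.span k {q} ∧ R2 q}.ncard ≤
      2 * ({W : Submodule k E | ∃ q ∈ V, q ≠ 0 ∧ W = Submodule.span k {q} ∧ F q}.ncard
        - {W : Submodule k E | ∃ q ∈ Q, q ≠ 0 ∧ W = Submodule.span k {q} ∧ R1 q}.ncard) + 1 := by
  classical
  set FS := {W : Submodule k E | ∃ q ∈ V, q ≠ 0 ∧ W = Submodule.span k {q} ∧ F q} with hFS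
  set S1 := {W : Submodule k E | ∃ q ∈ Q, q ≠ 0 ∧ W = Submodule.span k {q} ∧ R1 q} with hS1d
  set S2 := {W : Submodule k E | ∃ q ∈ Q, q ≠ 0 ∧ W = Submodule.span k {q} ∧ R2 q} with hS2d
  have he0 : e ≠ 0 := by rintro rfl; exact he V.zero_mem
  have heQ : e ∈ Q := hQ ▸ Submodule.mem_sup_left (Submodule.mem_span_singleton_self e)
  have hVQ : ∀ q ∈ V, q ∈ Q := fun q hq => hQ ▸ Submodule.mem_sup_right hq
  have hmemQ : ∀ q ∈ V, ∀ x : k, q + x • e ∈ Q := fun q hq x =>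
    Q.add_mem (hVQ q hq) (Q.smul_mem _ heQ)
  have hne0 : ∀ q ∈ V, q ≠ 0 → ∀ x : k, q + x • e ≠ 0 := by
    intro q hq hq0 x h
    have := s7_uniq V e he q 0 hq V.zero_mem x 0 1 (by simpa using h)
    exact hq0 (by simpa using this.1)
  have hdec : ∀ p ∈ Q, ∃ q ∈ V, ∃ x : k, p = q + x • e := by
    intro p hp
    rw [hQ] at hp
    obtain ⟨y, hy, z, hz, rfl⟩ := Submodule.mem_sup.mp hp
    obtain ⟨c, rfl⟩ := Submodule.mem_span_singleton.mp hy
    exact ⟨z, hz, c, add_comm _ _⟩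
  have hrep : ∀ W : Submodule k E, ∃ q : E, W ∈ FS →
      q ∈ V ∧ q ≠ 0 ∧ W = Submodule.span k {q} ∧ F q := by
    intro W
    by_cases h : W ∈ FS
    · obtain ⟨q, h⟩ := h
      exact ⟨q, fun _ => h⟩
    · exact ⟨0, fun h' => absurd h' h⟩
  choose r hr using hrep
  -- every rank ≤ 2 element other than e comes from a chosen representative
  have hfib : ∀ p ∈ Q, p ≠ 0 → (R1 p ∨ R2 p) → Submodule.span k {p} ≠ Submodule.span k {e} →
      ∃ W ∈ FS, ∃ x : k, Submodule.span k {p} = Submodule.span k {r W + x • e} ∧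
        (R1 p → R1 (r W + x • e)) ∧ (R2 p → R2 (r W + x • e)) := by
    intro p hp hp0 hR hpe
    obtain ⟨q, hq, x, rfl⟩ := hdec p hp
    have hq0 : q ≠ 0 := by
      rintro rfl
      rw [zero_add] at hpe hp0
      apply hpe
      apply s7_span_smul
      rintro rfl
      simp at hp0
    have hW : Submodule.span k {q} ∈ FS := ⟨q, hq, hq0, rfl, hA q hq hq0 x hR⟩
    obtain ⟨h1, h2, h3, h4⟩ := hr _ hW
    obtain ⟨c, hc, hc'⟩ := s7_span_eq h2 h3.symm
    refine ⟨_, hW, c * x, ?_, ?_, ?_⟩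
    all_goals
      have heq : r (Submodule.span k {q}) + (c * x) • e = c • (q + x • e) := by
        rw [smul_add, smul_smul, ← hc']
      rw [heq]
    · exact (s7_span_smul c hc _).symm
    · exact hs1 c hc _ hp
    · exact hs2 c hc _ hp
  set F1 := {W ∈ FS | ∃ l : k, R1 (r W + l • e)} with hF1
  have hex : ∀ W : Submodule k E, ∃ x y : k, W ∈ FS → ∀ l : k, R2 (r W + l • e) → l = x ∨ l = y := by
    intro W
    by_cases h : W ∈ FS
    · obtain ⟨x, y, hxy⟩ := hB (r W) (hr W h).1 (hr W h).2.1
      exact ⟨x, y, fun _ => hxy⟩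
    · exact ⟨0, 0, fun h' => absurd h' h⟩
  choose X Y hXY using hex
  have hfinD : (FS \ F1).Finite := hF.subset Set.diff_subset
  let U : Finset (Submodule k E) := hfinD.toFinset.biUnion
    (fun W => {Submodule.span k {r W + X W • e}, Submodule.span k {r W + Y W • e}})
  have hsub : S2 ⊆ (insert (Submodule.span k {e}) U : Finset (Submodule k E)) := by
    rintro _ ⟨p, hp, hp0, rfl, hR⟩
    by_cases hpe : Submodule.span k {p} = Submodule.span k {e}
    · simp [hpe]
    · obtain ⟨W, hW, x, h1, h2, h3⟩ := hfib p hp hp0 (Or.inr hR) hpe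
      have hx' := hXY W hW x (h3 hR)
      have hWF1 : W ∉ F1 := by
        rintro ⟨_, l, hl⟩
        exact hC _ (hr W hW).1 (hr W hW).2.1 l x hl (h3 hR)
      rw [Finset.mem_coe, Finset.mem_insert]
      right
      rw [Finset.mem_biUnion]
      refine ⟨W, by simpa using ⟨hW, hWF1⟩, ?_⟩
      rw [h1]
      rcases hx' with rfl | rfl <;> simp
  have hS2fin : S2.Finite := (Finset.finite_toSet _).subset hsub
  have hS1fin : S1.Finite := hS1.finite
  have hF1card : S1.ncard ≤ F1.ncard := by
    have h1 : S1.ncard ≤ 1 := (Set.ncard_le_one hS1fin).mpr fun _ ha _ hb => hS1 ha hb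
    rcases S1.eq_empty_or_nonempty with h | ⟨_, p, hp, hp0, rfl, hR⟩
    · simp [h]
    · have hF1fin : F1.Finite := hF.subset (fun W h => h.1)
      have hpe : Submodule.span k {p} ≠ Submodule.span k {e} := by
        intro h
        obtain ⟨c, hc, rfl⟩ := s7_span_eq hp0 h
        exact hx _ hp hR (hs2 c hc e heQ he2)
      obtain ⟨W, hW, x, h1', h2, h3⟩ := hfib p hp hp0 (Or.inl hR) hpe
      have : 0 < F1.ncard := (Set.ncard_pos hF1fin).mpr ⟨W, hW, x, h2 hR⟩
      omega
  constructor
  · have hle : FS.ncard ≤ (S1 ∪ S2).ncard := by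
      let f : Submodule k E → Submodule k E := fun W =>
        if h : ∃ l : k, R1 (r W + l • e) ∨ R2 (r W + l • e) then
          Submodule.span k {r W + h.choose • e} else Submodule.span k {e}
      have hfne : ∀ q ∈ V, q ≠ 0 → ∀ x : k,
          Submodule.span k {q + x • e} ≠ Submodule.span k {e} := by
        intro q hq hq0 x h
        obtain ⟨c, hc, h'⟩ := s7_span_eq (hne0 q hq hq0 x) h
        have := s7_uniq V e he q 0 hq V.zero_mem x 1 c (by simpa using h')
        exact hq0 (by simpa using this.1)
      refine Set.ncard_le_ncard_of_injOn f ?_ ?_ (hS1fin.union hS2fin)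
      · intro W hW
        obtain ⟨h1, h2, h3, h4⟩ := hr W hW
        by_cases h : ∃ l : k, R1 (r W + l • e) ∨ R2 (r W + l • e)
        · simp only [f, dif_pos h]
          rcases h.choose_spec with h' | h'
          · exact Or.inl ⟨_, hmemQ _ h1 _, hne0 _ h1 h2 _, rfl, h'⟩
          · exact Or.inr ⟨_, hmemQ _ h1 _, hne0 _ h1 h2 _, rfl, h'⟩
        · simp only [f, dif_neg h]
          exact Or.inr ⟨e, heQ, he0, rfl, he2⟩
      · intro W hW W' hW' hff
        obtain ⟨h1, h2, h3, h4⟩ := hr W hW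
        obtain ⟨h1', h2', h3', h4'⟩ := hr W' hW'
        by_cases h : ∃ l : k, R1 (r W + l • e) ∨ R2 (r W + l • e) <;>
        by_cases h' : ∃ l : k, R1 (r W' + l • e) ∨ R2 (r W' + l • e)
        · simp only [f, dif_pos h, dif_pos h'] at hff
          obtain ⟨c, hc, hc'⟩ := s7_span_eq (hne0 _ h1 h2 _) hff
          have := (s7_uniq V e he _ _ h1 h1' _ _ c hc').1
          rw [h3, h3', this, s7_span_smul c hc]
        · simp only [f, dif_pos h, dif_neg h'] at hff
          exact absurd hff (hfne _ h1 h2 _)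
        · simp only [f, dif_neg h, dif_pos h'] at hff
          exact absurd hff.symm (hfne _ h1' h2' _)
        · rw [h3, h3']
          exact hD _ h1 h2 _ h1' h2' h4 h4' h h'
    have := Set.ncard_union_le S1 S2
    omega
  · have h1 : S2.ncard ≤ (insert (Submodule.span k {e}) U).card := by
      rw [← Set.ncard_coe_finset]
      exact Set.ncard_le_ncard hsub (Finset.finite_toSet _)
    have h2 : (insert (Submodule.span k {e}) U).card ≤ U.card + 1 := Finset.card_insert_le _ _
    have h3 : U.card ≤ hfinD.toFinset.card * 2 :=
      Finset.card_biUnion_le_card_mul _ _ _ (fun W _ => Finset.card_le_two)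
    have h4 : hfinD.toFinset.card = FS.ncard - F1.ncard := by
      rw [← Set.ncard_eq_toFinset_card _ hfinD]
      exact Set.ncard_diff (fun W h => h.1) (hF.subset (fun W h => h.1))
    omega

end Count

section Poly
variable {k : Type*} [Field k]

theorem s7_eval_quad (N : Matrix (Fin 4) (Fin 4) k) (v : Fin 4 → k) :
    eval v (quadOfMat k N) = s7_form N v := by
  simp only [quadOfMat, s7_form, map_sum, smul_eval, map_mul, eval_X]
  refine Finset.sum_congr rfl fun i _ => Finset.sum_congr rfl fun j _ => ?_
  ring

/-- Polarization with respect to the vectors `g`. -/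
def s7_T (g : Matrix (Fin 4) (Fin 4) k) :
    MvPolynomial (Fin 4) k →ₗ[k] Matrix (Fin 4) (Fin 4) k where
  toFun p := Matrix.of fun i j => (eval (g i + g j) p - eval (g i) p - eval (g j) p) / 2
  map_add' p q := by
    ext i j; simp; ring
  map_smul' c p := by
    ext i j; simp [smul_eval]; ring

theorem s7_T_symm (g : Matrix (Fin 4) (Fin 4) k) (p : MvPolynomial (Fin 4) k) :
    (s7_T g p).IsSymm := by
  ext i j
  simp [s7_T, add_comm (g i) (g j)]
  ring

theorem s7_form_eq (N : Matrix (Fin 4) (Fin 4) k) (v : Fin 4 → k) :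
    s7_form N v = v ⬝ᵥ N.mulVec v := by
  simp only [s7_form, dotProduct, Matrix.mulVec, Finset.mul_sum]
  refine Finset.sum_congr rfl fun i _ => Finset.sum_congr rfl fun j _ => ?_
  ring

theorem s7_T_quad (hchar : (2 : k) ≠ 0) (g N : Matrix (Fin 4) (Fin 4) k) (hN : N.IsSymm) :
    s7_T g (quadOfMat k N) = g * N * g.transpose := by
  ext i j
  have h1 : (g * N * g.transpose) i j = g i ⬝ᵥ N.mulVec (g j) := by
    rw [Matrix.mul_assoc, Matrix.mul_apply]
    simp only [dotProduct]
    refine Finset.sum_congr rfl fun a _ => ?_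
    congr 1
  have h2 : g j ⬝ᵥ N.mulVec (g i) = g i ⬝ᵥ N.mulVec (g j) := by
    rw [Matrix.dotProduct_mulVec, ← Matrix.mulVec_transpose, hN.eq, dotProduct_comm]
  rw [h1]
  simp only [s7_T, LinearMap.coe_mk, AddHom.coe_mk, Matrix.of_apply, s7_eval_quad, s7_form_eq,
    Matrix.mulVec_add, add_dotProduct, dotProduct_add]
  rw [h2]
  field_simp
  ring

theorem s7_form_T (hchar : (2 : k) ≠ 0) (g N : Matrix (Fin 4) (Fin 4) k) (hN : N.IsSymm)
    (x : Fin 4 → k) :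
    s7_form (s7_T g (quadOfMat k N)) x = eval (Matrix.vecMul x g) (quadOfMat k N) := by
  rw [s7_T_quad hchar g N hN, s7_eval_quad, s7_form_eq, s7_form_eq, ← Matrix.mulVec_mulVec,
    ← Matrix.mulVec_mulVec, Matrix.mulVec_transpose, Matrix.dotProduct_mulVec x g]

theorem s7_rank_T (hchar : (2 : k) ≠ 0) (g N : Matrix (Fin 4) (Fin 4) k) (hN : N.IsSymm)
    (hg : IsUnit g.det) : (s7_T g (quadOfMat k N)).rank = N.rank := by
  rw [s7_T_quad hchar g N hN, Matrix.rank_mul_eq_left_of_isUnit_det _ _ (by simpa using hg),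
    Matrix.rank_mul_eq_right_of_isUnit_det _ _ hg]

theorem s7_linear (a : MvPolynomial (Fin 4) k) (ha : a ∈ homogeneousSubmodule (Fin 4) k 1) :
    ∃ α : Fin 4 → k, a = ∑ i, α i • X i := by
  rw [homogeneousSubmodule_one_eq_span_X] at ha
  obtain ⟨c, hc⟩ := (Submodule.mem_span_range_iff_exists_fun k).mp ha
  exact ⟨c, hc.symm⟩

/-- `quadOfMat` as a linear map. -/
def s7_quadLin (k : Type*) [Field k] :
    Matrix (Fin 4) (Fin 4) k →ₗ[k] MvPolynomial (Fin 4) k where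
  toFun N := quadOfMat k N
  map_add' p q := by
    simp [quadOfMat, add_smul, Finset.sum_add_distrib]
  map_smul' c p := by
    simp [quadOfMat, Finset.smul_sum, smul_smul]

theorem s7_exists_mat (hchar : (2 : k) ≠ 0) (q : MvPolynomial (Fin 4) k)
    (hq : q ∈ homogeneousSubmodule (Fin 4) k 2) :
    ∃ N : Matrix (Fin 4) (Fin 4) k, N.IsSymm ∧ q = quadOfMat k N := by
  have h1 : ∃ N : Matrix (Fin 4) (Fin 4) k, q = quadOfMat k N := by
    suffices h : homogeneousSubmodule (Fin 4) k 2 ≤ LinearMap.range (s7_quadLin k) by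
      obtain ⟨N, hN⟩ := h hq
      exact ⟨N, hN.symm⟩
    rw [← homogeneousSubmodule_one_pow, pow_two, Submodule.mul_le]
    intro a ha b hb
    obtain ⟨α, rfl⟩ := s7_linear a ha
    obtain ⟨β, rfl⟩ := s7_linear b hb
    refine ⟨Matrix.of fun i j => α i * β j, ?_⟩
    simp only [s7_quadLin, quadOfMat, LinearMap.coe_mk, AddHom.coe_mk, Matrix.of_apply,
      Finset.sum_mul_sum, smul_mul_smul_comm]
  obtain ⟨N, rfl⟩ := h1
  refine ⟨(2 : k)⁻¹ • (N + N.transpose), ?_, ?_⟩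
  · rw [Matrix.IsSymm, Matrix.transpose_smul, Matrix.transpose_add, Matrix.transpose_transpose,
      add_comm]
  · have ht : quadOfMat k N.transpose = quadOfMat k N := by
      simp only [quadOfMat, Matrix.transpose_apply]
      rw [Finset.sum_comm]
      refine Finset.sum_congr rfl fun i _ => Finset.sum_congr rfl fun j _ => ?_
      rw [mul_comm]
    have e : quadOfMat k ((2 : k)⁻¹ • (N + N.transpose))
        = (2 : k)⁻¹ • (quadOfMat k N + quadOfMat k N.transpose) := by
      have := (s7_quadLin k).map_smul (2 : k)⁻¹ (N + N.transpose)
      rw [map_add] at this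
      exact this
    rw [e, ht, ← two_smul k, smul_smul, inv_mul_cancel₀ hchar, one_smul]

theorem s7_hasRank_iff (hchar : (2 : k) ≠ 0) (g : Matrix (Fin 4) (Fin 4) k)
    (hg : IsUnit g.det) (q : MvPolynomial (Fin 4) k)
    (hq : q ∈ homogeneousSubmodule (Fin 4) k 2) (r : ℕ) :
    HasRank k q r ↔ (s7_T g q).rank = r := by
  constructor
  · rintro ⟨N, hN, rfl, hr⟩
    rw [s7_rank_T hchar g N hN hg, hr]
  · intro h
    obtain ⟨N, hN, rfl⟩ := s7_exists_mat hchar q hq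
    rw [s7_rank_T hchar g N hN hg] at h
    exact ⟨N, hN, rfl, h⟩

theorem s7_extend {n : ℕ} (hn : n < 4) (v : Fin n → Fin 4 → k) (hv : LinearIndependent k v) :
    ∃ x : Fin 4 → k, LinearIndependent k (Fin.snoc v x : Fin (n + 1) → Fin 4 → k) := by
  have : ∃ x, x ∉ Submodule.span k (Set.range v) := by
    by_contra hc
    push Not at hc
    have h1 : Submodule.span k (Set.range v) = ⊤ := by
      rw [eq_top_iff]; intro x _; exact hc x
    have h2 := finrank_span_eq_card hv
    rw [h1, finrank_top] at h2
    simp at h2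
    omega
  obtain ⟨x, hx⟩ := this
  exact ⟨x, linearIndependent_finSnoc.mpr ⟨hv, hx⟩⟩

theorem s7_frame (a b : MvPolynomial (Fin 4) k)
    (ha : a ∈ homogeneousSubmodule (Fin 4) k 1)
    (hb : b ∈ homogeneousSubmodule (Fin 4) k 1)
    (hab : LinearIndependent k ![a, b]) :
    ∃ g : Matrix (Fin 4) (Fin 4) k, IsUnit g.det ∧
      (∀ x : Fin 4 → k, eval (Matrix.vecMul x g) a = x 0) ∧
      (∀ x : Fin 4 → k, eval (Matrix.vecMul x g) b = x 1) := by
  obtain ⟨α, rfl⟩ := s7_linear a ha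
  obtain ⟨β, rfl⟩ := s7_linear b hb
  have hli : LinearIndependent k ![α, β] := by
    let f : (Fin 4 → k) →ₗ[k] MvPolynomial (Fin 4) k :=
      Fintype.linearCombination k (fun i => (X i : MvPolynomial (Fin 4) k))
    apply LinearIndependent.of_comp f
    convert hab using 1
    funext i
    fin_cases i <;> simp [f, Fintype.linearCombination_apply]
  obtain ⟨γ, h3⟩ := s7_extend (by norm_num) _ hli
  obtain ⟨δ, h4⟩ := s7_extend (by norm_num) _ h3
  let H : Matrix (Fin 4) (Fin 4) k := Matrix.of (Fin.snoc (Fin.snoc ![α, β] γ : Fin 3 → Fin 4 → k) δ)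
  have hH : IsUnit H := Matrix.linearIndependent_rows_iff_isUnit.mp h4
  have hHd : IsUnit H.det := (Matrix.isUnit_iff_isUnit_det _).mp hH
  have key : ∀ x : Fin 4 → k, H.mulVec (Matrix.vecMul x (H⁻¹).transpose) = x := by
    intro x
    rw [Matrix.vecMul_transpose, Matrix.mulVec_mulVec, Matrix.mul_nonsing_inv _ hHd,
      Matrix.one_mulVec]
  refine ⟨(H⁻¹).transpose, ?_, ?_, ?_⟩
  · rw [Matrix.det_transpose]
    exact Matrix.isUnit_nonsing_inv_det _ hHd
  · intro x
    have := congrFun (key x) 0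
    rw [← this]
    simp [smul_eval, Matrix.mulVec, dotProduct]
    rfl
  · intro x
    have := congrFun (key x) 1
    rw [← this]
    simp [smul_eval, Matrix.mulVec, dotProduct]
    rfl

theorem s7_gram (g N : Matrix (Fin 4) (Fin 4) k) (c : Fin 3 → Fin 4) :
    (g.submatrix c id) * N * (g.submatrix c id).transpose
      = (g * N * g.transpose).submatrix c c := by
  ext i j
  simp [Matrix.mul_apply]

theorem s7_rest_det (hchar : (2 : k) ≠ 0) (g : Matrix (Fin 4) (Fin 4) k)
    (q l : MvPolynomial (Fin 4) k) (c : Fin 3 → Fin 4)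
    (hl : ∀ j, eval (g (c j)) l = 0) (h : RestRankLE k q l 2) :
    ((s7_T g q).submatrix c c).det = 0 := by
  obtain ⟨N, P, hN, rfl, hinj, hker, hr⟩ := h
  have hw : ∀ j, ∃ w, P.mulVec w = g (c j) := fun j => (hker _).mpr (hl j)
  choose w hw using hw
  have hP : (g.submatrix c id).transpose = P * (Matrix.of w).transpose := by
    ext i j
    have := congrFun (hw j) i
    simp only [Matrix.transpose_apply, Matrix.submatrix_apply, id]
    rw [← this]
    rfl
  have hP' : g.submatrix c id = Matrix.of w * P.transpose := by
    rw [← Matrix.transpose_transpose (g.submatrix c id), hP, Matrix.transpose_mul,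
      Matrix.transpose_transpose]
  rw [s7_T_quad hchar g N hN, ← s7_gram, hP, hP']
  have e : Matrix.of w * P.transpose * N * (P * (Matrix.of w).transpose)
      = Matrix.of w * (P.transpose * N * P) * (Matrix.of w).transpose := by
    simp only [Matrix.mul_assoc]
  rw [e, Matrix.det_mul, Matrix.det_mul]
  have : (P.transpose * N * P).det = 0 := by
    by_contra hd
    have h1 := Matrix.rank_of_isUnit (P.transpose * N * P)
      ((Matrix.isUnit_iff_isUnit_det _).mpr (isUnit_iff_ne_zero.mpr hd))
    rw [Fintype.card_fin] at h1
    omega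
  rw [this]; ring

theorem s7_det_rest (hchar : (2 : k) ≠ 0) (g : Matrix (Fin 4) (Fin 4) k) (hg : IsUnit g.det)
    (q l : MvPolynomial (Fin 4) k) (hq : q ∈ homogeneousSubmodule (Fin 4) k 2) (i0 : Fin 4)
    (hl : ∀ x : Fin 4 → k, eval (Matrix.vecMul x g) l = x i0)
    (h : ((s7_T g q).submatrix i0.succAbove i0.succAbove).rank ≤ 2) :
    RestRankLE k q l 2 := by
  obtain ⟨N, hN, rfl⟩ := s7_exists_mat hchar q hq
  have hmul : ∀ w : Fin 3 → k, (g.submatrix i0.succAbove id).transpose.mulVec w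
      = Matrix.vecMul (i0.insertNth (α := fun _ => k) 0 w) g := by
    intro w
    funext i
    rw [Matrix.mulVec_transpose]
    simp only [Matrix.vecMul, dotProduct, Fin.sum_univ_succAbove _ i0]
    simp
  have hginj : Function.Injective (fun x : Fin 4 → k => Matrix.vecMul x g) :=
    Matrix.vecMul_injective_of_isUnit ((Matrix.isUnit_iff_isUnit_det _).mpr hg)
  refine ⟨N, (g.submatrix i0.succAbove id).transpose, hN, rfl, ?_, ?_, ?_⟩
  · intro w w' hww
    simp only [hmul] at hww
    have := hginj hww
    funext j
    have := congrFun this (i0.succAbove j)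
    simpa using this
  · intro v
    constructor
    · rintro ⟨w, rfl⟩
      rw [hmul, hl]
      simp
    · intro hv
      have hx : Matrix.vecMul (Matrix.vecMul v g⁻¹) g = v := by
        rw [Matrix.vecMul_vecMul, Matrix.nonsing_inv_mul _ hg, Matrix.vecMul_one]
      rw [← hx, hl] at hv
      refine ⟨fun j => Matrix.vecMul v g⁻¹ (i0.succAbove j), ?_⟩
      rw [hmul]
      conv_rhs => rw [← hx]
      congr 1
      funext i
      refine Fin.succAboveCases i0 ?_ ?_ i
      · simp [hv]
      · simp
  · rw [Matrix.transpose_transpose, s7_gram, ← s7_T_quad hchar g N hN]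
    exact h

theorem s7_T_ab (hchar : (2 : k) ≠ 0) (g : Matrix (Fin 4) (Fin 4) k)
    (a b : MvPolynomial (Fin 4) k)
    (hga : ∀ x : Fin 4 → k, eval (Matrix.vecMul x g) a = x 0)
    (hgb : ∀ x : Fin 4 → k, eval (Matrix.vecMul x g) b = x 1) :
    s7_T g (a * b) = (2 : k)⁻¹ • s7_M k := by
  have h1 : ∀ i, g i = Matrix.vecMul (Pi.single i 1) g := by
    intro i; rw [Matrix.single_one_vecMul]; rfl
  ext i j
  simp only [s7_T, LinearMap.coe_mk, AddHom.coe_mk, Matrix.of_apply, map_mul]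
  rw [h1 i, h1 j, ← Matrix.add_vecMul]
  simp only [hga, hgb]
  fin_cases i <;> fin_cases j <;> simp [s7_M] <;> field_simp <;> ring

theorem s7_hasRank_smul (c : k) (hc : c ≠ 0) (q : MvPolynomial (Fin 4) k) (r : ℕ)
    (h : HasRank k q r) : HasRank k (c • q) r := by
  obtain ⟨N, hN, rfl, hr⟩ := h
  refine ⟨c • N, ?_, ((s7_quadLin k).map_smul c N).symm, ?_⟩
  · rw [Matrix.IsSymm, Matrix.transpose_smul, hN.eq]
  · have : c • N = (c • (1 : Matrix (Fin 4) (Fin 4) k)) * N := by simp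
    rw [this, Matrix.rank_mul_eq_right_of_isUnit_det, hr]
    simp [Matrix.det_smul, hc]

end Poly

theorem stmt7 (k : Type*) [Field k] [IsAlgClosed k] (hchar : (2 : k) ≠ 0)
    (a b : MvPolynomial (Fin 4) k)
    (ha : a ∈ homogeneousSubmodule (Fin 4) k 1)
    (hb : b ∈ homogeneousSubmodule (Fin 4) k 1)
    (hab : LinearIndependent k ![a, b])
    (𝔮 : Submodule k (MvPolynomial (Fin 4) k))
    (h𝔮sub : 𝔮 ≤ homogeneousSubmodule (Fin 4) k 2)
    (h𝔮dim : Module.finrank k 𝔮 = 3)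
    (habn : a * b ∉ 𝔮)
    (𝔔 : Submodule k (MvPolynomial (Fin 4) k))
    (h𝔔 : 𝔔 = Submodule.span k {a * b} ⊔ 𝔮)
    (hbpf : BPFree k 𝔔)
    (m : ℕ)
    (hF : {W : Submodule k (MvPolynomial (Fin 4) k) |
        ∃ q ∈ 𝔮, q ≠ 0 ∧ W = Submodule.span k {q} ∧
          RestRankLE k q a 2 ∧ RestRankLE k q b 2}.Finite)
    (hm : {W : Submodule k (MvPolynomial (Fin 4) k) |
        ∃ q ∈ 𝔮, q ≠ 0 ∧ W = Submodule.span k {q} ∧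
          RestRankLE k q a 2 ∧ RestRankLE k q b 2}.ncard = m)
    (r₁ : ℕ)
    (hr₁ : {W : Submodule k (MvPolynomial (Fin 4) k) |
        ∃ q ∈ 𝔔, q ≠ 0 ∧ W = Submodule.span k {q} ∧
          HasRank k q 1}.ncard = r₁)
    (hr1le : {W : Submodule k (MvPolynomial (Fin 4) k) |
        ∃ q ∈ 𝔔, q ≠ 0 ∧ W = Submodule.span k {q} ∧
          HasRank k q 1}.Subsingleton)
    (r₂ : ℕ)
    (hr₂ : {W : Submodule k (MvPolynomial (Fin 4) k) |
        ∃ q ∈ 𝔔, q ≠ 0 ∧ W = Submodule.span k {q} ∧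
          HasRank k q 2}.ncard = r₂) :
    m - r₁ ≤ r₂ ∧ r₂ ≤ 2 * (m - r₁) + 1 := by
  classical
  obtain ⟨g, hg, hga, hgb⟩ := s7_frame a b ha hb hab
  have hTab := s7_T_ab hchar g a b hga hgb
  have habR : a * b ∈ homogeneousSubmodule (Fin 4) k 2 := by
    have := IsHomogeneous.mul ha hb
    exact this
  have hQR : 𝔔 ≤ homogeneousSubmodule (Fin 4) k 2 := by
    rw [h𝔔]
    refine sup_le ?_ h𝔮sub
    rw [Submodule.span_le]
    simpa using habR
  have heQ : a * b ∈ 𝔔 := h𝔔 ▸ Submodule.mem_sup_left (Submodule.mem_span_singleton_self _)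
  have hVQ : 𝔮 ≤ 𝔔 := h𝔔 ▸ le_sup_right
  have hmemQ : ∀ q ∈ 𝔮, ∀ x : k, q + x • (a * b) ∈ 𝔔 := fun q hq x =>
    𝔔.add_mem (hVQ hq) (𝔔.smul_mem _ heQ)
  have hTx : ∀ q, ∀ x : k, s7_T g (q + x • (a * b)) = s7_T g q + (x / 2) • s7_M k := by
    intro q x
    rw [map_add, map_smul, hTab, smul_smul, div_eq_mul_inv]
  have hrk : ∀ q ∈ 𝔔, ∀ r : ℕ, HasRank k q r ↔ (s7_T g q).rank = r := fun q hq r =>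
    s7_hasRank_iff hchar g hg q (hQR hq) r
  have hrkx : ∀ q ∈ 𝔮, ∀ x : k, ∀ r : ℕ, HasRank k (q + x • (a * b)) r ↔
      (s7_T g q + (x / 2) • s7_M k).rank = r := by
    intro q hq x r
    rw [hrk _ (hmemQ q hq x), hTx]
  have hne0 : ∀ q ∈ 𝔮, q ≠ 0 → ∀ x : k, q + x • (a * b) ≠ 0 := by
    intro q hq hq0 x h
    have := s7_uniq 𝔮 (a * b) habn q 0 hq 𝔮.zero_mem x 0 1 (by simpa using h)
    exact hq0 (by simpa using this.1)
  have hsymm := s7_T_symm g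
  have hbpf' : ∀ x : Fin 4 → k, x 0 * x 1 = 0 →
      (∀ p ∈ 𝔮, s7_form (s7_T g p) x = 0) → x = 0 := by
    intro x hx01 hx
    have hform : ∀ p ∈ 𝔔, s7_form (s7_T g p) x = eval (Matrix.vecMul x g) p := by
      intro p hp
      obtain ⟨N, hN, rfl⟩ := s7_exists_mat hchar p (hQR hp)
      exact s7_form_T hchar g N hN x
    have h0 := hbpf (Matrix.vecMul x g) (by
      intro p hp
      rw [h𝔔] at hp
      obtain ⟨y, hy, z, hz, rfl⟩ := Submodule.mem_sup.mp hp
      obtain ⟨c, rfl⟩ := Submodule.mem_span_singleton.mp hy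
      rw [map_add, smul_eval, map_mul, hga, hgb, hx01, ← hform z (hVQ hz), hx z hz]
      simp)
    have hginj : Function.Injective (fun x : Fin 4 → k => Matrix.vecMul x g) :=
      Matrix.vecMul_injective_of_isUnit ((Matrix.isUnit_iff_isUnit_det _).mpr hg)
    apply hginj
    simpa using h0
  have hr1' : ∀ q ∈ 𝔮, q ≠ 0 → ∀ l m : k, (s7_T g q + l • s7_M k).rank = 1 →
      (s7_T g q + m • s7_M k).rank = 1 → l = m := by
    intro q hq hq0 l m hl hm
    have e1 : ∀ l : k, l = (2 * l) / 2 := fun l => by field_simp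
    rw [e1 l, ← hrkx q hq] at hl
    rw [e1 m, ← hrkx q hq] at hm
    have hsp := hr1le ⟨_, hmemQ q hq _, hne0 q hq hq0 _, rfl, hl⟩
      ⟨_, hmemQ q hq _, hne0 q hq hq0 _, rfl, hm⟩
    obtain ⟨c, hc, hc'⟩ := s7_span_eq (hne0 q hq hq0 _) hsp
    obtain ⟨h1, h2⟩ := s7_uniq 𝔮 (a * b) habn q q hq hq _ _ c hc'
    have hc1 : c = 1 := by
      have : (1 - c) • q = 0 := by rw [sub_smul, one_smul, ← h1, sub_self]
      rcases smul_eq_zero.mp this with h | h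
      · linear_combination -h
      · exact absurd h hq0
    rw [hc1, one_mul] at h2
    exact mul_left_cancel₀ hchar h2
  have hc0 : (![1, 2, 3] : Fin 3 → Fin 4) = Fin.succAbove 0 := by decide
  have hc1 : (![0, 2, 3] : Fin 3 → Fin 4) = Fin.succAbove 1 := by decide
  have hgi : ∀ i, g i = Matrix.vecMul (Pi.single i 1) g := by
    intro i; rw [Matrix.single_one_vecMul]; rfl
  subst hm hr₁ hr₂
  refine s7_count 𝔮 𝔔 (a * b) habn h𝔔 (fun q => RestRankLE k q a 2 ∧ RestRankLE k q b 2)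
    (fun q => HasRank k q 1) (fun q => HasRank k q 2) ?_ ?_ ?_ ?_ ?_ ?_ ?_ ?_ hF hr1le
  · rw [hrk _ heQ, hTab]
    apply le_antisymm
    · have heq : (2 : k)⁻¹ • s7_M k = (!![1, 0; 0, 1; 0, 0; 0, 0] : Matrix (Fin 4) (Fin 2) k)
          * (!![0, 2⁻¹, 0, 0; 2⁻¹, 0, 0, 0] : Matrix (Fin 2) (Fin 4) k) := by
        ext i j
        fin_cases i <;> fin_cases j <;> simp [s7_M]
      rw [heq]
      refine (Matrix.rank_mul_le_left _ _).trans ?_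
      simpa using Matrix.rank_le_width (!![1, 0; 0, 1; 0, 0; 0, 0] : Matrix (Fin 4) (Fin 2) k)
    · by_contra hlt
      have := s7_minor2 ((2 : k)⁻¹ • s7_M k) (by omega) 0 1 0 1
      simp [s7_M, hchar] at this
  · intro c hc p hp h
    exact s7_hasRank_smul c hc p 1 h
  · intro c hc p hp h
    exact s7_hasRank_smul c hc p 2 h
  · intro p hp h1 h2
    rw [hrk p hp] at h1 h2
    omega
  · intro q hq hq0 x hR
    have hle : (s7_T g q + (x / 2) • s7_M k).rank ≤ 2 := by
      rcases hR with h | h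
      · rw [hrkx q hq] at h; omega
      · rw [hrkx q hq] at h; omega
    constructor
    · refine s7_det_rest hchar g hg q a (h𝔮sub hq) 0 hga ?_
      have e : (s7_T g q).submatrix (Fin.succAbove 0) (Fin.succAbove 0)
          = (s7_T g q + (x / 2) • s7_M k).submatrix (Fin.succAbove 0) (Fin.succAbove 0) := by
        rw [← hc0]
        ext i j
        fin_cases i <;> fin_cases j <;> simp [s7_M]
      rw [e]
      exact (Matrix.rank_submatrix_le _ _ _).trans hle
    · refine s7_det_rest hchar g hg q b (h𝔮sub hq) 1 hgb ?_
      have e : (s7_T g q).submatrix (Fin.succAbove 1) (Fin.succAbove 1)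
          = (s7_T g q + (x / 2) • s7_M k).submatrix (Fin.succAbove 1) (Fin.succAbove 1) := by
        rw [← hc1]
        ext i j
        fin_cases i <;> fin_cases j <;> simp [s7_M]
      rw [e]
      exact (Matrix.rank_submatrix_le _ _ _).trans hle
  · intro q hq hq0
    obtain ⟨x, y, hxy⟩ := s7_B hchar (s7_T g) hsymm 𝔮 h𝔮dim hbpf' hr1' q hq hq0
    refine ⟨2 * x, 2 * y, fun l hl => ?_⟩
    rw [hrkx q hq] at hl
    rcases hxy _ hl.le with h | h
    · left; rw [← h]; field_simp
    · right; rw [← h]; field_simp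
  · intro q hq hq0 l m hl hm
    rw [hrkx q hq] at hl hm
    have := s7_C hchar (s7_T g) hsymm 𝔮 h𝔮dim hbpf' hr1' q hq hq0 _ _ hl hm.le
    rw [this] at hm
    omega
  · have hU : ∀ q ∈ 𝔮, q ≠ 0 → (RestRankLE k q a 2 ∧ RestRankLE k q b 2) →
        (¬ ∃ l : k, HasRank k (q + l • (a * b)) 1 ∨ HasRank k (q + l • (a * b)) 2) →
        s7_T g q 2 2 = 0 ∧ s7_T g q 3 3 = 0 ∧ s7_T g q 2 3 = 0 := by
      intro q hq hq0 hFq hno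
      by_contra hcon
      apply hno
      obtain ⟨l, hl⟩ := s7_D hchar (s7_T g q) (hsymm q)
        (s7_rest_det hchar g q a _ (by
          intro j; rw [hgi, hga]; fin_cases j <;> simp) hFq.1)
        (s7_rest_det hchar g q b _ (by
          intro j; rw [hgi, hgb]; fin_cases j <;> simp) hFq.2) hcon
      refine ⟨2 * l, ?_⟩
      rw [hrkx q hq, hrkx q hq]
      have e1 : (2 * l) / 2 = l := by field_simp
      rw [e1]
      have h0 : (s7_T g q + l • s7_M k).rank ≠ 0 := by
        intro h
        have h := s7_rank_zero _ h
        apply hcon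
        have a1 := congrFun (congrFun h 2) 2
        have a2 := congrFun (congrFun h 3) 3
        have a3 := congrFun (congrFun h 2) 3
        simp [s7_M] at a1 a2 a3
        exact ⟨a1, a2, a3⟩
      omega
    intro q hq hq0 q' hq' hq0' hFq hFq' hn hn'
    obtain ⟨u1, u2, u3⟩ := hU q hq hq0 hFq hn
    obtain ⟨v1, v2, v3⟩ := hU q' hq' hq0' hFq' hn'
    by_contra hsp
    refine s7_noU hchar (s7_T g) hsymm 𝔮 h𝔮dim hbpf' q q' hq hq' ?_ u1 u2 u3 v1 v2 v3
    rw [LinearIndependent.pair_iff' hq0]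
    rintro c rfl
    apply hsp
    rw [s7_span_smul]
    rintro rfl
    simp at hq0'

end
end

section
/- Let a, b, c, d be a basis of R₁ and let 𝔮 = k(a² − b²) ⊕ k(a² − c²) ⊕ k(a² − d²) ⊆ R₂. Then exactly six one-dimensional subspaces of 𝔮 are spanned by a quadratic form of rank exactly two, and no one-dimensional subspace of 𝔮 is spanned by a quadratic form of rank one. ([SV], Example 5.1, first claim.) -/
/-!
STATEMENT 9: [SV, Example 5.1, first claim]. Let a, b, c, d be a basis of R₁
and 𝔮 = k(a² − b²) ⊕ k(a² − c²) ⊕ k(a² − d²). Then exactly six one-dimensional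
subspaces of 𝔮 are spanned by a quadratic form of rank exactly two, and none
is spanned by a quadratic form of rank one.
-/

noncomputable section

open MvPolynomial

theorem eval_quadOfMat_s9 {k : Type*} [Field k] (N : Matrix (Fin 4) (Fin 4) k) (v : Fin 4 → k) :
    MvPolynomial.eval v (quadOfMat k N) = ∑ i, ∑ j, N i j * (v i * v j) := by
  simp [quadOfMat, MvPolynomial.smul_eval]

theorem quadOfMat_inj {k : Type*} [Field k] (hchar : (2 : k) ≠ 0)
    {M N : Matrix (Fin 4) (Fin 4) k} (hM : M.IsSymm) (hN : N.IsSymm)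
    (h : quadOfMat k M = quadOfMat k N) : M = N := by
  have hv : ∀ v : Fin 4 → k, ∑ i, ∑ j, M i j * (v i * v j) = ∑ i, ∑ j, N i j * (v i * v j) := by
    intro v
    rw [← eval_quadOfMat_s9, ← eval_quadOfMat_s9, h]
  have single_sum : ∀ (A : Matrix (Fin 4) (Fin 4) k) (p : Fin 4),
      ∑ i, ∑ j, A i j * ((Pi.single p 1 : Fin 4 → k) i * (Pi.single p 1 : Fin 4 → k) j)
        = A p p := by
    intro A p
    simp [Pi.single_apply]
  have pair_sum : ∀ (A : Matrix (Fin 4) (Fin 4) k) (p q : Fin 4),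
      ∑ i, ∑ j, A i j * ((Pi.single p 1 + Pi.single q 1 : Fin 4 → k) i *
        (Pi.single p 1 + Pi.single q 1 : Fin 4 → k) j)
        = A p p + A p q + A q p + A q q := by
    intro A p q
    simp [Pi.single_apply, mul_add, add_mul, Finset.sum_add_distrib]
    ring
  have hd : ∀ p, M p p = N p p := by
    intro p
    rw [← single_sum M p, ← single_sum N p, hv]
  ext p q
  have h1 := hv (Pi.single p 1 + Pi.single q 1)
  rw [pair_sum, pair_sum, hd p, hd q, hM.apply p q, hN.apply p q] at h1
  apply mul_left_cancel₀ hchar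
  linear_combination h1

/-- The diagonal form with coefficients `e` in the linear forms `l`. -/
def diagForm {k : Type*} [Field k] (l : Fin 4 → MvPolynomial (Fin 4) k) :
    (Fin 4 → k) →ₗ[k] MvPolynomial (Fin 4) k where
  toFun e := ∑ i, e i • (l i) ^ 2
  map_add' x y := by simp [add_smul, Finset.sum_add_distrib]
  map_smul' t x := by simp [mul_smul, Finset.smul_sum]

theorem linear_form_eq {k : Type*} [Field k] (t : MvPolynomial (Fin 4) k)
    (ht : t ∈ homogeneousSubmodule (Fin 4) k 1) :
    ∃ p : Fin 4 → k, t = ∑ j, p j • X j := by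
  rw [MvPolynomial.homogeneousSubmodule_one_eq_span_X, Submodule.mem_span_range_iff_exists_fun] at ht
  obtain ⟨p, hp⟩ := ht
  exact ⟨p, hp.symm⟩

theorem diagForm_eq {k : Type*} [Field k] (l : Fin 4 → MvPolynomial (Fin 4) k)
    (P : Matrix (Fin 4) (Fin 4) k) (hP : ∀ i, l i = ∑ j, P i j • X j) (e : Fin 4 → k) :
    diagForm l e = quadOfMat k (P.transpose * Matrix.diagonal e * P) := by
  have h1 : ∀ i j, (P.transpose * Matrix.diagonal e * P) i j = ∑ x, P x i * e x * P x j := by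
    intro i j
    rw [Matrix.mul_apply]
    simp only [Matrix.mul_diagonal, Matrix.transpose_apply]
  simp only [quadOfMat, h1, Finset.sum_smul]
  have h2 : ∀ x, e x • l x ^ 2
      = ∑ i, ∑ j, (P x i * e x * P x j) • (X i * X j : MvPolynomial (Fin 4) k) := by
    intro x
    rw [hP x, pow_two, Finset.sum_mul_sum, Finset.smul_sum]
    refine Finset.sum_congr rfl fun i _ => ?_
    rw [Finset.smul_sum]
    refine Finset.sum_congr rfl fun j _ => ?_
    rw [smul_mul_smul_comm, smul_smul]
    congr 1
    ring
  change ∑ x, e x • l x ^ 2 = _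
  rw [Finset.sum_congr rfl fun x _ => h2 x, Finset.sum_comm]
  refine Finset.sum_congr rfl fun i _ => ?_
  rw [Finset.sum_comm]

theorem P_unit {k : Type*} [Field k] (l : Fin 4 → MvPolynomial (Fin 4) k)
    (hl : LinearIndependent k l)
    (P : Matrix (Fin 4) (Fin 4) k) (hP : ∀ i, l i = ∑ j, P i j • X j) : IsUnit P := by
  rw [← Matrix.linearIndependent_rows_iff_isUnit]
  apply LinearIndependent.of_comp (Fintype.linearCombination k (X : Fin 4 → MvPolynomial (Fin 4) k))
  convert hl using 1
  funext i
  rw [hP i]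
  rfl

theorem hasRank_diag {k : Type*} [Field k] (hchar : (2 : k) ≠ 0)
    (l : Fin 4 → MvPolynomial (Fin 4) k)
    (P : Matrix (Fin 4) (Fin 4) k) (hP : ∀ i, l i = ∑ j, P i j • X j) (hu : IsUnit P)
    (e : Fin 4 → k) (r : ℕ) :
    HasRank k (diagForm l e) r ↔ Nat.card {i // e i ≠ 0} = r := by
  classical
  have hs : (P.transpose * Matrix.diagonal e * P).IsSymm := by
    simp [Matrix.IsSymm, Matrix.mul_assoc]
  have hr : (P.transpose * Matrix.diagonal e * P).rank = Nat.card {i // e i ≠ 0} := by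
    have hd : IsUnit P.det := (Matrix.isUnit_iff_isUnit_det _).1 hu
    rw [Matrix.rank_mul_eq_left_of_isUnit_det _ _ hd,
      Matrix.rank_mul_eq_right_of_isUnit_det _ _ (by rwa [Matrix.det_transpose]),
      Matrix.rank_diagonal, Nat.card_eq_fintype_card]
  constructor
  · rintro ⟨N, hN, h, rfl⟩
    rw [diagForm_eq l P hP] at h
    rw [← hr, quadOfMat_inj hchar hs hN h]
  · intro h
    exact ⟨_, hs, diagForm_eq l P hP e, hr.trans h⟩

theorem diagForm_inj {k : Type*} [Field k] (hchar : (2 : k) ≠ 0)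
    (l : Fin 4 → MvPolynomial (Fin 4) k)
    (P : Matrix (Fin 4) (Fin 4) k) (hP : ∀ i, l i = ∑ j, P i j • X j) (hu : IsUnit P) :
    Function.Injective (diagForm l) := by
  rw [injective_iff_map_eq_zero]
  intro e he
  have h : HasRank k (diagForm l e) 0 := by
    rw [he]
    exact ⟨0, Matrix.isSymm_zero, by simp [quadOfMat], Matrix.rank_zero⟩
  rw [hasRank_diag hchar l P hP hu, Nat.card_eq_zero] at h
  rcases h with h | h
  · funext i
    by_contra hi
    exact h.false ⟨i, hi⟩
  · exact absurd h (not_infinite_iff_finite.2 inferInstance)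

theorem mem_q {k : Type*} [Field k] (a b c d q : MvPolynomial (Fin 4) k) :
    q ∈ Submodule.span k {a ^ 2 - b ^ 2, a ^ 2 - c ^ 2, a ^ 2 - d ^ 2} ↔
      ∃ e : Fin 4 → k, ∑ i, e i = 0 ∧ q = diagForm ![a, b, c, d] e := by
  rw [Submodule.mem_span_triple]
  constructor
  · rintro ⟨x, y, z, rfl⟩
    refine ⟨![x + y + z, -x, -y, -z], ?_, ?_⟩
    · simp [Fin.sum_univ_four]
      ring
    · simp only [diagForm, LinearMap.coe_mk, AddHom.coe_mk, Fin.sum_univ_four]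
      simp
      module
  · rintro ⟨e, he, rfl⟩
    refine ⟨-e 1, -e 2, -e 3, ?_⟩
    rw [Fin.sum_univ_four] at he
    have h0 : e 0 = -(e 1 + e 2 + e 3) := by linear_combination he
    simp only [diagForm, LinearMap.coe_mk, AddHom.coe_mk, Fin.sum_univ_four, h0]
    simp
    module

theorem card_single {k : Type*} [Field k] (e : Fin 4 → k) (he : ∑ i, e i = 0) :
    Nat.card {i // e i ≠ 0} ≠ 1 := by
  classical
  rw [Nat.card_eq_fintype_card, Fintype.card_subtype]
  intro h
  obtain ⟨i, hi⟩ := Finset.card_eq_one.1 h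
  rw [← Finset.sum_filter_ne_zero, hi, Finset.sum_singleton] at he
  have : i ∈ Finset.univ.filter (fun i => e i ≠ 0) := by rw [hi]; simp
  simp [he] at this

theorem card_pair {k : Type*} [Field k] (e : Fin 4 → k) (he : ∑ i, e i = 0)
    (h : Nat.card {i // e i ≠ 0} = 2) :
    ∃ i j : Fin 4, i < j ∧ ∃ t : k, t ≠ 0 ∧ e = t • (Pi.single i 1 - Pi.single j 1) := by
  classical
  rw [Nat.card_eq_fintype_card, Fintype.card_subtype] at h
  obtain ⟨i, j, hij, hs⟩ := Finset.card_eq_two.1 h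
  rw [← Finset.sum_filter_ne_zero, hs, Finset.sum_pair hij] at he
  have hm : ∀ x, e x ≠ 0 ↔ x = i ∨ x = j := by
    intro x
    have : x ∈ Finset.univ.filter (fun i => e i ≠ 0) ↔ x ∈ ({i, j} : Finset (Fin 4)) := by rw [hs]
    simpa using this
  have key : e = e i • (Pi.single i 1 - Pi.single j 1) := by
    funext x
    by_cases hxi : x = i
    · subst hxi
      simp [hij]
    · by_cases hxj : x = j
      · subst hxj
        simp [hij.symm]
        linear_combination he
      · have : e x = 0 := by
          by_contra h0
          rcases (hm x).1 h0 with h1 | h1 <;> contradiction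
        simp [this, hxi, hxj]
  rcases lt_or_gt_of_ne hij with hlt | hlt
  · exact ⟨i, j, hlt, e i, (hm i).2 (Or.inl rfl), key⟩
  · refine ⟨j, i, hlt, -e i, neg_ne_zero.2 ((hm i).2 (Or.inl rfl)), ?_⟩
    rw [neg_smul, ← smul_neg, neg_sub]
    exact key

theorem card_pair' {k : Type*} [Field k] (i j : Fin 4) (hij : i < j) :
    Nat.card {x // (Pi.single i 1 - Pi.single j 1 : Fin 4 → k) x ≠ 0} = 2 := by
  classical
  rw [Nat.card_eq_fintype_card, Fintype.card_subtype, Finset.card_eq_two]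
  refine ⟨i, j, hij.ne, ?_⟩
  ext x
  by_cases hxi : x = i
  · subst hxi
    simp [hij.ne]
  · by_cases hxj : x = j
    · subst hxj
      simp [hij.ne']
    · simp [hxi, hxj]

theorem stmt9 (k : Type*) [Field k] [IsAlgClosed k] (hchar : (2 : k) ≠ 0)
    (a b c d : MvPolynomial (Fin 4) k)
    (hmem : ∀ t ∈ ({a, b, c, d} : Set (MvPolynomial (Fin 4) k)),
      t ∈ homogeneousSubmodule (Fin 4) k 1)
    (hind : LinearIndependent k ![a, b, c, d])
    (hspan : Submodule.span k {a, b, c, d} =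
      homogeneousSubmodule (Fin 4) k 1)
    (𝔮 : Submodule k (MvPolynomial (Fin 4) k))
    (h𝔮 : 𝔮 = Submodule.span k {a ^ 2 - b ^ 2, a ^ 2 - c ^ 2, a ^ 2 - d ^ 2}) :
    {W : Submodule k (MvPolynomial (Fin 4) k) |
        ∃ q ∈ 𝔮, q ≠ 0 ∧ W = Submodule.span k {q} ∧ HasRank k q 2}.ncard = 6 ∧
    {W : Submodule k (MvPolynomial (Fin 4) k) |
        ∃ q ∈ 𝔮, q ≠ 0 ∧ W = Submodule.span k {q} ∧ HasRank k q 1} = ∅ := by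
  classical
  subst h𝔮
  have hl : ∀ i, ∃ p : Fin 4 → k, (![a, b, c, d] : Fin 4 → MvPolynomial (Fin 4) k) i
      = ∑ j, p j • X j := by
    intro i
    apply linear_form_eq
    apply hmem
    fin_cases i <;> simp
  choose P hP using hl
  have hu : IsUnit (Matrix.of P) := P_unit _ hind (Matrix.of P) hP
  have hrank := hasRank_diag hchar _ (Matrix.of P) hP hu
  have hinj := diagForm_inj hchar _ (Matrix.of P) hP hu
  set φ := diagForm ![a, b, c, d] with hφ
  constructor
  · let S : Finset (Fin 4 × Fin 4) := Finset.univ.filter (fun p => p.1 < p.2)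
    let u : Fin 4 × Fin 4 → (Fin 4 → k) := fun p => Pi.single p.1 1 - Pi.single p.2 1
    let F : Fin 4 × Fin 4 → Submodule k (MvPolynomial (Fin 4) k) :=
      fun p => Submodule.span k {φ (u p)}
    have hset : {W : Submodule k (MvPolynomial (Fin 4) k) |
        ∃ q ∈ Submodule.span k {a ^ 2 - b ^ 2, a ^ 2 - c ^ 2, a ^ 2 - d ^ 2},
          q ≠ 0 ∧ W = Submodule.span k {q} ∧ HasRank k q 2} = F '' (S : Set (Fin 4 × Fin 4)) := by
      ext W
      simp only [Set.mem_setOf_eq, Set.mem_image]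
      constructor
      · rintro ⟨q, hq, -, rfl, hr⟩
        obtain ⟨e, he, rfl⟩ := (mem_q a b c d q).1 hq
        obtain ⟨i, j, hij, t, ht, rfl⟩ := card_pair e he ((hrank e 2).1 hr)
        refine ⟨(i, j), by simpa [S] using hij, ?_⟩
        simp only [F, u, ← hφ, map_smul]
        exact (Submodule.span_singleton_smul_eq (IsUnit.mk0 t ht) _).symm
      · rintro ⟨⟨i, j⟩, hp, rfl⟩
        have hij : i < j := by simpa [S] using hp
        have hc := card_pair' (k := k) i j hij
        refine ⟨φ (u (i, j)), (mem_q a b c d _).2 ⟨u (i, j), by simp [u], rfl⟩, ?_, rfl,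
          (hrank _ 2).2 hc⟩
        intro h0
        have h1 : u (i, j) = 0 := hinj (by rw [h0, map_zero])
        have h2 := congrFun h1 i
        simp [u, hij.ne] at h2
    have hF : Set.InjOn F (S : Set (Fin 4 × Fin 4)) := by
      rintro ⟨i, j⟩ h1 ⟨i', j'⟩ h2 h
      have hij : i < j := by simpa [S] using h1
      have hij' : i' < j' := by simpa [S] using h2
      obtain ⟨z, hz⟩ := Submodule.span_singleton_eq_span_singleton.1 h
      rw [Units.smul_def, ← map_smul] at hz
      have hz' := hinj hz
      have hm : ∀ (p q x : Fin 4), p < q → (u (p, q) x ≠ 0 ↔ x = p ∨ x = q) := by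
        intro p q x hpq
        by_cases hxi : x = p
        · subst hxi
          simp [u, hpq.ne]
        · by_cases hxj : x = q
          · subst hxj
            simp [u, hpq.ne']
          · simp [u, hxi, hxj]
      have hh : ∀ x, (x = i ∨ x = j) ↔ (x = i' ∨ x = j') := by
        intro x
        rw [← hm i j x hij, ← hm i' j' x hij', ← hz']
        simp
      have e1 := (hh i).1 (Or.inl rfl)
      have e2 := (hh j).1 (Or.inr rfl)
      rw [Prod.mk.injEq]
      omega
    rw [hset, Set.ncard_image_of_injOn hF, Set.ncard_coe_finset]
    decide
  · rw [Set.eq_empty_iff_forall_notMem]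
    rintro W ⟨q, hq, -, -, hr⟩
    obtain ⟨e, he, rfl⟩ := (mem_q a b c d q).1 hq
    exact card_single e he ((hrank e 1).1 hr)

end
end

section
/- Let f ∈ k[x, y, z] be an irreducible homogeneous cubic such that the projective plane curve V(f) has exactly one singular point. Then there exist a linear change of coordinates g ∈ GL₃(k) and λ ∈ k^× such that λ·(f∘g) equals x³ + y³ + xyz, or y³ + x²z, or y³ + x²z + xy²; moreover, if char(k) ≠ 3 then λ·(f∘g) equals x³ + y³ + xyz or y³ + x²z. ([NVZ], Lemma 2.1.) -/
/-!
STATEMENT 11: [NVZ, Lemma 2.1]. Let f ∈ k[x, y, z] be an irreducible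
homogeneous cubic such that the projective plane curve V(f) has exactly one
singular point. Then, after a linear change of coordinates g ∈ GL₃(k) and
rescaling by λ ∈ k^×, λ·(f∘g) equals x³ + y³ + xyz, or y³ + x²z, or
y³ + x²z + xy²; moreover, if char(k) ≠ 3 then λ·(f∘g) equals one of the first
two.
-/

noncomputable section

open MvPolynomial


/-- Linear substitution of variables. -/
def subst11 {k : Type*} [Field k] (g : Matrix (Fin 3) (Fin 3) k) :
    MvPolynomial (Fin 3) k →ₐ[k] MvPolynomial (Fin 3) k :=
  aeval (fun i => ∑ j, g i j • (X j : MvPolynomial (Fin 3) k))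

/-- The conclusion of the theorem. -/
def Good11 {k : Type*} [Field k] (f : MvPolynomial (Fin 3) k) : Prop :=
  ∃ (g : Matrix (Fin 3) (Fin 3) k), IsUnit g ∧
      ∃ lam : k, lam ≠ 0 ∧
        (lam • subst11 g f = X 0 ^ 3 + X 1 ^ 3 + X 0 * X 1 * X 2 ∨
         lam • subst11 g f = X 1 ^ 3 + X 0 ^ 2 * X 2 ∨
         lam • subst11 g f = X 1 ^ 3 + X 0 ^ 2 * X 2 + X 0 * X 1 ^ 2) ∧
        ((3 : k) ≠ 0 →
          (lam • subst11 g f = X 0 ^ 3 + X 1 ^ 3 + X 0 * X 1 * X 2 ∨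
           lam • subst11 g f = X 1 ^ 3 + X 0 ^ 2 * X 2))

lemma subst11_subst11 {k : Type*} [Field k] (g h : Matrix (Fin 3) (Fin 3) k)
    (f : MvPolynomial (Fin 3) k) : subst11 h (subst11 g f) = subst11 (g * h) f := by
  have : (subst11 h).comp (subst11 g) = subst11 (g * h) := by
    apply MvPolynomial.algHom_ext
    intro i
    simp only [subst11, AlgHom.comp_apply, aeval_X, map_sum, map_smul, Matrix.mul_apply,
      Finset.smul_sum, Finset.sum_smul, smul_smul]
    rw [Finset.sum_comm]
  rw [← this]; rfl

lemma subst11_one {k : Type*} [Field k] (f : MvPolynomial (Fin 3) k) : subst11 1 f = f := by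
  have : subst11 (1 : Matrix (Fin 3) (Fin 3) k) = AlgHom.id k _ := by
    apply MvPolynomial.algHom_ext
    intro i
    simp [subst11, Matrix.one_apply]
  rw [this]; rfl

lemma Good11.of_subst {k : Type*} [Field k] {f : MvPolynomial (Fin 3) k}
    {g : Matrix (Fin 3) (Fin 3) k} (hg : IsUnit g) {l : k} (hl : l ≠ 0)
    (h : Good11 (l • subst11 g f)) : Good11 f := by
  obtain ⟨g', hg', m, hm, h⟩ := h
  refine ⟨g * g', hg.mul hg', m * l, mul_ne_zero hm hl, ?_⟩
  simpa only [map_smul, subst11_subst11, smul_smul] using h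

lemma irreducible_subst11 {k : Type*} [Field k] {f : MvPolynomial (Fin 3) k}
    {g : Matrix (Fin 3) (Fin 3) k} (hg : IsUnit g) {l : k} (hl : l ≠ 0)
    (h : Irreducible f) : Irreducible (l • subst11 g f) := by
  obtain ⟨u, rfl⟩ := hg
  let e : MvPolynomial (Fin 3) k ≃ₐ[k] MvPolynomial (Fin 3) k :=
    AlgEquiv.ofAlgHom (subst11 u.1) (subst11 u.inv)
      (by ext1 i; simp [subst11_subst11, subst11_one])
      (by ext1 i; simp [subst11_subst11, subst11_one])
  have h1 : Irreducible (subst11 u.1 f) := (MulEquiv.irreducible_iff e).2 h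
  have hu : IsUnit (C l : MvPolynomial (Fin 3) k) := (isUnit_iff_ne_zero.2 hl).map C
  rw [smul_eq_C_mul]
  exact (irreducible_isUnit_mul hu).2 h1

lemma not_irr11 {k : Type*} [Field k] {f A B : MvPolynomial (Fin 3) k}
    (h : Irreducible f) (e : f = A * B) (hA : eval 0 A = 0) (hB : eval 0 B = 0) : False := by
  rcases h.isUnit_or_isUnit e with h | h
  · exact (h.map (eval (0 : Fin 3 → k))).ne_zero hA
  · exact (h.map (eval (0 : Fin 3 → k))).ne_zero hB

/-- A cubic singular at `(0,0,1)`. -/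
def cub11 {k : Type*} [Field k] (a b c p q r s : k) : MvPolynomial (Fin 3) k :=
  X 2 * (C a * X 0 ^ 2 + C b * X 0 * X 1 + C c * X 1 ^ 2) +
    (C p * X 0 ^ 3 + C q * X 0 ^ 2 * X 1 + C r * X 0 * X 1 ^ 2 + C s * X 1 ^ 3)

/-- Irreducible implies conclusion. -/
def R11 {k : Type*} [Field k] (f : MvPolynomial (Fin 3) k) : Prop := Irreducible f → Good11 f

lemma R11.of_subst {k : Type*} [Field k] {f : MvPolynomial (Fin 3) k}
    {g : Matrix (Fin 3) (Fin 3) k} (hg : IsUnit g) {l : k} (hl : l ≠ 0)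
    (h : R11 (l • subst11 g f)) : R11 f := fun hf =>
  Good11.of_subst hg hl (h (irreducible_subst11 hg hl hf))

lemma step11 {k : Type*} [Field k] {a b c p q r s : k} (u m n v x y w l : k)
    (hl : l ≠ 0) (hd : w * (u * v - m * n) ≠ 0) {a' b' c' p' q' r' s' : k}
    (h : R11 (cub11 a' b' c' p' q' r' s'))
    (ha : a' = l * (w * (a * u ^ 2 + b * u * n + c * n ^ 2)))
    (hb : b' = l * (w * (2 * a * u * m + b * (u * v + m * n) + 2 * c * n * v)))
    (hc : c' = l * (w * (a * m ^ 2 + b * m * v + c * v ^ 2)))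
    (hp : p' = l * (x * (a * u ^ 2 + b * u * n + c * n ^ 2) +
      p * u ^ 3 + q * u ^ 2 * n + r * u * n ^ 2 + s * n ^ 3))
    (hq : q' = l * (x * (2 * a * u * m + b * (u * v + m * n) + 2 * c * n * v) +
      y * (a * u ^ 2 + b * u * n + c * n ^ 2) + 3 * p * u ^ 2 * m +
      q * (u ^ 2 * v + 2 * u * m * n) + r * (2 * u * n * v + m * n ^ 2) + 3 * s * n ^ 2 * v))
    (hr : r' = l * (y * (2 * a * u * m + b * (u * v + m * n) + 2 * c * n * v) +
      x * (a * m ^ 2 + b * m * v + c * v ^ 2) + 3 * p * u * m ^ 2 +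
      q * (2 * u * m * v + m ^ 2 * n) + r * (u * v ^ 2 + 2 * m * n * v) + 3 * s * n * v ^ 2))
    (hs : s' = l * (y * (a * m ^ 2 + b * m * v + c * v ^ 2) +
      p * m ^ 3 + q * m ^ 2 * v + r * m * v ^ 2 + s * v ^ 3)) :
    R11 (cub11 a b c p q r s) := by
  have hg : IsUnit (!![u, m, 0; n, v, 0; x, y, w] : Matrix (Fin 3) (Fin 3) k) := by
    rw [Matrix.isUnit_iff_isUnit_det, isUnit_iff_ne_zero, Matrix.det_fin_three]
    convert hd using 1
    simp
    ring
  refine R11.of_subst hg hl ?_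
  convert h using 1
  subst ha hb hc hp hq hr hs
  have e2 : (C (2 : k) : MvPolynomial (Fin 3) k) = 2 := map_ofNat C 2
  have e3 : (C (3 : k) : MvPolynomial (Fin 3) k) = 3 := map_ofNat C 3
  simp [cub11, subst11, Fin.sum_univ_three, smul_eq_C_mul, e2, e3]
  ring

lemma finA11 {k : Type*} [Field k] : R11 (cub11 (k := k) 0 1 0 1 0 0 1) := by
  intro _
  have : (1 : k) • subst11 1 (cub11 (k := k) 0 1 0 1 0 0 1) =
      X 0 ^ 3 + X 1 ^ 3 + X 0 * X 1 * X 2 := by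
    rw [subst11_one]; simp [cub11]; ring
  exact ⟨1, isUnit_one, 1, one_ne_zero, Or.inl this, fun _ => Or.inl this⟩

lemma finB11 {k : Type*} [Field k] : R11 (cub11 (k := k) 1 0 0 0 0 0 1) := by
  intro _
  have : (1 : k) • subst11 1 (cub11 (k := k) 1 0 0 0 0 0 1) =
      X 1 ^ 3 + X 0 ^ 2 * X 2 := by
    rw [subst11_one]; simp [cub11]; ring
  exact ⟨1, isUnit_one, 1, one_ne_zero, Or.inr (Or.inl this), fun _ => Or.inr this⟩

lemma finC11 {k : Type*} [Field k] (h3 : (3 : k) = 0) :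
    R11 (cub11 (k := k) 1 0 0 0 0 1 1) := by
  intro _
  have : (1 : k) • subst11 1 (cub11 (k := k) 1 0 0 0 0 1 1) =
      X 1 ^ 3 + X 0 ^ 2 * X 2 + X 0 * X 1 ^ 2 := by
    rw [subst11_one]; simp [cub11]; ring
  exact ⟨1, isUnit_one, 1, one_ne_zero, Or.inr (Or.inr this), fun h => absurd h3 h⟩

/-- nodal case -/
lemma node11 {k : Type*} [Field k] [IsAlgClosed k] (p q r s : k) :
    R11 (cub11 0 1 0 p q r s) := by
  refine step11 1 0 0 1 (-q) (-r) 1 1 one_ne_zero (by simp) (a' := 0) (b' := 1) (c' := 0)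
    (p' := p) (q' := 0) (r' := 0) (s' := s) ?_ (by ring) (by ring) (by ring) (by ring) (by ring)
    (by ring) (by ring)
  by_cases hp : p = 0
  · intro h
    refine (not_irr11 h (A := X 1) (B := X 2 * X 0 + C s * X 1 ^ 2) ?_ (by simp) (by simp)).elim
    simp [cub11, hp]; ring
  by_cases hs : s = 0
  · intro h
    refine (not_irr11 h (A := X 0) (B := X 2 * X 1 + C p * X 0 ^ 2) ?_ (by simp) (by simp)).elim
    simp [cub11, hs]; ring
  obtain ⟨u, hu⟩ := IsAlgClosed.exists_pow_nat_eq p (n := 3) (by norm_num)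
  obtain ⟨v, hv⟩ := IsAlgClosed.exists_pow_nat_eq s (n := 3) (by norm_num)
  have hu0 : u ≠ 0 := by rintro rfl; apply hp; rw [← hu]; simp
  have hv0 : v ≠ 0 := by rintro rfl; apply hs; rw [← hv]; simp
  subst hu hv
  refine step11 u⁻¹ 0 0 v⁻¹ 0 0 (u * v) 1 one_ne_zero ?_ finA11 ?_ ?_ ?_ ?_ ?_ ?_ ?_ <;>
    field_simp <;> simp

/-- cuspidal case -/
lemma cusp11 {k : Type*} [Field k] [IsAlgClosed k] (p q r s : k) :
    R11 (cub11 1 0 0 p q r s) := by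
  refine step11 1 0 0 1 (-p) (-q) 1 1 one_ne_zero (by simp) (a' := 1) (b' := 0) (c' := 0)
    (p' := 0) (q' := 0) (r' := r) (s' := s) ?_ (by ring) (by ring) (by ring) (by ring) (by ring)
    (by ring) (by ring)
  by_cases hs : s = 0
  · intro h
    refine (not_irr11 h (A := X 0) (B := X 2 * X 0 + C r * X 1 ^ 2) ?_ (by simp) (by simp)).elim
    simp [cub11, hs]; ring
  obtain ⟨v, hv⟩ := IsAlgClosed.exists_pow_nat_eq s (n := 3) (by norm_num)
  have hv0 : v ≠ 0 := by rintro rfl; apply hs; rw [← hv]; simp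
  subst hv
  refine step11 1 0 0 v⁻¹ 0 0 1 1 one_ne_zero (by simpa using hv0) (a' := 1) (b' := 0) (c' := 0)
    (p' := 0) (q' := 0) (r' := r / v ^ 2) (s' := 1) ?_ (by simp) (by simp) (by simp) (by simp)
    (by simp) (by field_simp; simp) (by field_simp; simp)
  generalize r / v ^ 2 = t
  by_cases h3 : (3 : k) = 0
  · by_cases ht : t = 0
    · rw [ht]; exact finB11
    · refine step11 t⁻¹ 0 0 1 0 0 (t ^ 2) 1 one_ne_zero ?_ (finC11 h3) ?_ ?_ ?_ ?_ ?_ ?_ ?_ <;>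
        field_simp <;> simp [ht]
  · refine step11 1 0 (-t / 3) 1 (-2 * t ^ 3 / 27) (t ^ 2 / 3) 1 1 one_ne_zero (by simp) finB11
      ?_ ?_ ?_ ?_ ?_ ?_ ?_
    · simp
    · simp
    · simp
    · have : (27 : k) ≠ 0 := by
        have : (27 : k) = 3 ^ 3 := by norm_num
        rw [this]; exact pow_ne_zero _ h3
      field_simp; ring
    · field_simp; ring
    · field_simp; ring
    · simp

lemma root2_11 {k : Type*} [Field k] [IsAlgClosed k] (a b c : k) (ha : a ≠ 0) :
    ∃ t, a * t ^ 2 + b * t + c = 0 := by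
  have hd := Polynomial.degree_quadratic (R := k) (a := a) (b := b) (c := c) ha
  obtain ⟨t, ht⟩ := IsAlgClosed.exists_root _ (by rw [hd]; decide)
  exact ⟨t, by simpa [Polynomial.IsRoot] using ht⟩

lemma root3_11 {k : Type*} [Field k] [IsAlgClosed k] (a b c d : k) (ha : a ≠ 0) :
    ∃ t, a * t ^ 3 + b * t ^ 2 + c * t + d = 0 := by
  have hd := Polynomial.degree_cubic (R := k) (a := a) (b := b) (c := c) (d := d) ha
  obtain ⟨t, ht⟩ := IsAlgClosed.exists_root _ (by rw [hd]; decide)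
  exact ⟨t, by simpa [Polynomial.IsRoot] using ht⟩

/-- quadratic part with a factor `x` -/
lemma quad0_11 {k : Type*} [Field k] [IsAlgClosed k] (a b p q r s : k) (h : a ≠ 0 ∨ b ≠ 0) :
    R11 (cub11 a b 0 p q r s) := by
  by_cases hb : b = 0
  · have ha : a ≠ 0 := by tauto
    subst hb
    refine step11 1 0 0 1 0 0 1 a⁻¹ (inv_ne_zero ha) (by simp) (cusp11 (a⁻¹ * p) (a⁻¹ * q)
      (a⁻¹ * r) (a⁻¹ * s)) ?_ ?_ ?_ ?_ ?_ ?_ ?_ <;> simp [ha]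
  · refine step11 1 0 (-a / b) (1 / b) 0 0 1 1 one_ne_zero (by simpa using hb) (node11 _ _ _ _)
      ?_ ?_ ?_ rfl rfl rfl rfl
    · field_simp; ring
    · field_simp; ring
    · simp

lemma cone0_11 {k : Type*} [Field k] (p q r : k) : R11 (cub11 0 0 0 p q r 0) := by
  intro h
  refine (not_irr11 h (A := X 0) (B := C p * X 0 ^ 2 + C q * X 0 * X 1 + C r * X 1 ^ 2)
      ?_ (by simp) (by simp)).elim
  unfold cub11; rw [C_0]; ring

lemma cone11 {k : Type*} [Field k] [IsAlgClosed k] (p q r s : k) :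
    R11 (cub11 0 0 0 p q r s) := by
  by_cases hp : p = 0
  · intro h
    refine (not_irr11 h (A := X 1) (B := C q * X 0 ^ 2 + C r * X 0 * X 1 + C s * X 1 ^ 2)
      ?_ (by simp) (by simp)).elim
    simp [cub11, hp]; ring
  obtain ⟨t, ht⟩ := root3_11 p q r s hp
  refine step11 1 t 0 1 0 0 1 1 one_ne_zero (by simp) (s' := 0) (a' := 0) (b' := 0) (c' := 0)
    (cone0_11 _ _ _) (by ring) (by ring) (by ring) rfl rfl rfl (by linear_combination -ht)

lemma all11 {k : Type*} [Field k] [IsAlgClosed k] (a b c p q r s : k) :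
    R11 (cub11 a b c p q r s) := by
  by_cases ha : a = 0
  · subst ha
    by_cases h : c ≠ 0 ∨ b ≠ 0
    · exact step11 0 1 1 0 0 0 1 1 one_ne_zero (by simp) (quad0_11 c b s r q p h)
        (by ring) (by ring) (by ring) (by ring) (by ring) (by ring) (by ring)
    · push Not at h
      rw [h.1, h.2]
      exact cone11 _ _ _ _
  · obtain ⟨t, ht⟩ := root2_11 a b c ha
    exact step11 1 t 0 1 0 0 1 1 one_ne_zero (by simp) (quad0_11 a (2 * a * t + b) _ _ _ _
      (Or.inl ha)) (by ring) (by ring) (by linear_combination -ht) rfl rfl rfl rfl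

lemma explicit11 {k : Type*} [Field k] {f : MvPolynomial (Fin 3) k} (hf : f.IsHomogeneous 3) :
    ∃ a b c p q r s x y z : k, f = cub11 a b c p q r s +
      (C x * X 0 * X 2 ^ 2 + C y * X 1 * X 2 ^ 2 + C z * X 2 ^ 3) := by
  rw [f.as_sum]
  apply Finset.sum_induction _ (fun f => ∃ a b c p q r s x y z : k, f = cub11 a b c p q r s +
      (C x * X 0 * X 2 ^ 2 + C y * X 1 * X 2 ^ 2 + C z * X 2 ^ 3))
  · rintro _ _ ⟨a, b, c, p, q, r, s, x, y, z, rfl⟩ ⟨a', b', c', p', q', r', s', x', y', z', rfl⟩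
    refine ⟨a + a', b + b', c + c', p + p', q + q', r + r', s + s', x + x', y + y', z + z', ?_⟩
    simp [cub11]; ring
  · exact ⟨0, 0, 0, 0, 0, 0, 0, 0, 0, 0, by simp [cub11]⟩
  · intro d hd
    have h := hf (mem_support_iff.1 hd)
    have h3 : d 0 + d 1 + d 2 = 3 := by
      rw [Finsupp.weight_apply, Finsupp.sum_fintype _ _ (by simp), Fin.sum_univ_three] at h
      simpa using h
    rw [monomial_eq, Finsupp.prod_fintype _ _ (by simp), Fin.prod_univ_three]
    generalize coeff d f = e
    generalize d 0 = i at *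
    generalize d 1 = j at *
    generalize d 2 = l at *
    have hi : i ≤ 3 := by omega
    have hj : j ≤ 3 := by omega
    obtain rfl : l = 3 - i - j := by omega
    clear h hd
    interval_cases i <;> interval_cases j <;> first | omega | skip
    · exact ⟨0, 0, 0, 0, 0, 0, 0, 0, 0, e, by simp [cub11]⟩
    · exact ⟨0, 0, 0, 0, 0, 0, 0, 0, e, 0, by simp [cub11]; ring⟩
    · exact ⟨0, 0, e, 0, 0, 0, 0, 0, 0, 0, by simp [cub11]; ring⟩
    · exact ⟨0, 0, 0, 0, 0, 0, e, 0, 0, 0, by simp [cub11]⟩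
    · exact ⟨0, 0, 0, 0, 0, 0, 0, e, 0, 0, by simp [cub11]; ring⟩
    · exact ⟨0, e, 0, 0, 0, 0, 0, 0, 0, 0, by simp [cub11]; ring⟩
    · exact ⟨0, 0, 0, 0, 0, e, 0, 0, 0, 0, by simp [cub11]; ring⟩
    · exact ⟨e, 0, 0, 0, 0, 0, 0, 0, 0, 0, by simp [cub11]; ring⟩
    · exact ⟨0, 0, 0, 0, e, 0, 0, 0, 0, 0, by simp [cub11]; ring⟩
    · exact ⟨0, 0, 0, e, 0, 0, 0, 0, 0, 0, by simp [cub11]⟩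

lemma chain11 {k : Type*} [Field k] (s : Fin 3 → MvPolynomial (Fin 3) k) (j : Fin 3)
    (f : MvPolynomial (Fin 3) k) :
    pderiv j (aeval s f) = ∑ i, aeval s (pderiv i f) * pderiv j (s i) := by
  induction f using MvPolynomial.induction_on with
  | C a => simp
  | add p q hp hq => simp only [map_add, hp, hq, add_mul, Finset.sum_add_distrib]
  | mul_X p n hp =>
    simp only [map_mul, Derivation.leibniz, aeval_X, hp, smul_eq_mul, map_add, add_mul,
      Finset.sum_add_distrib, pderiv_X, Finset.mul_sum]
    congr 1
    · rw [Finset.sum_eq_single n]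
      · simp
      · intro b _ hb
        simp [Pi.single_apply, hb, hb.symm]
      · simp
    · exact Finset.sum_congr rfl fun i _ => by ring

lemma frame11 {k : Type*} [Field k] (p : Fin 3 → k) (hp : p ≠ 0) :
    ∃ g : Matrix (Fin 3) (Fin 3) k, IsUnit g ∧ ∀ i, g i 2 = p i := by
  obtain ⟨i, hi⟩ := Function.ne_iff.1 hp
  simp only [Pi.zero_apply] at hi
  simp only [Matrix.isUnit_iff_isUnit_det, isUnit_iff_ne_zero, Matrix.det_fin_three]
  fin_cases i
  · exact ⟨!![0, 0, p 0; 1, 0, p 1; 0, 1, p 2], by simpa using hi, by simp [Fin.forall_fin_succ]⟩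
  · exact ⟨!![1, 0, p 0; 0, 0, p 1; 0, 1, p 2], by simpa using hi, by simp [Fin.forall_fin_succ]⟩
  · exact ⟨!![1, 0, p 0; 0, 1, p 1; 0, 0, p 2], by simpa using hi, by simp [Fin.forall_fin_succ]⟩

lemma main11 {k : Type*} [Field k] [IsAlgClosed k] (f : MvPolynomial (Fin 3) k)
    (hirr : Irreducible f) (hhom : f.IsHomogeneous 3)
    (p : Fin 3 → k) (hp : p ≠ 0)
    (hpf : eval p f = 0) (hpd : ∀ i, eval p (pderiv i f) = 0) : Good11 f := by
  obtain ⟨g, hg, hgp⟩ := frame11 p hp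
  refine R11.of_subst hg (one_ne_zero (α := k)) ?_ hirr
  rw [one_smul]
  have hev : ∀ h, eval (Pi.single 2 1) (subst11 g h) = eval p h := by
    intro h
    have : (aeval (Pi.single 2 1 : Fin 3 → k)).comp (subst11 g) = aeval p := by
      apply MvPolynomial.algHom_ext
      intro i
      simp [subst11, Fin.sum_univ_three, hgp, Pi.single_apply, smul_eq_C_mul]
    simpa [aeval_eq_eval] using congrArg (fun φ => φ h) this
  have hh : (subst11 g f).IsHomogeneous 3 := by
    have := hhom.aeval (fun i => ∑ j, g i j • (X j : MvPolynomial (Fin 3) k)) (n := 1)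
      (fun i => IsHomogeneous.sum _ _ _ fun j _ => by
        rw [smul_eq_C_mul]; exact (isHomogeneous_X k j).C_mul _)
    rw [one_mul] at this
    exact this
  have h0 := hev f
  rw [hpf] at h0
  have hd : ∀ j, eval (Pi.single 2 1) (pderiv j (subst11 g f)) = 0 := by
    intro j
    rw [subst11, chain11, map_sum]
    refine Finset.sum_eq_zero fun i _ => ?_
    rw [map_mul]
    have := hev (pderiv i f)
    rw [subst11] at this
    rw [this, hpd, zero_mul]
  obtain ⟨a, b, c, p, q, r, s, x, y, z, e⟩ := explicit11 hh
  rw [e] at h0 hd ⊢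
  have h1 := hd 0
  have h2 := hd 1
  simp [cub11, pderiv_X, Pi.single_apply] at h0 h1 h2
  subst h0 h1 h2
  simpa using all11 a b c p q r s

theorem stmt11 (k : Type*) [Field k] [IsAlgClosed k] (hchar : (2 : k) ≠ 0)
    (f : MvPolynomial (Fin 3) k)
    (hirr : Irreducible f)
    (hhom : f.IsHomogeneous 3)
    -- V(f) has exactly one singular point: there is a singular point p,
    -- and any singular point is a nonzero scalar multiple of p.
    (p : Fin 3 → k) (hp : p ≠ 0)
    (hpf : eval p f = 0) (hpd : ∀ i, eval p (pderiv i f) = 0)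
    (huniq : ∀ q : Fin 3 → k, q ≠ 0 → eval q f = 0 →
      (∀ i, eval q (pderiv i f) = 0) → ∃ t : k, t ≠ 0 ∧ q = t • p) :
    ∃ (g : Matrix (Fin 3) (Fin 3) k), IsUnit g ∧
      ∃ lam : k, lam ≠ 0 ∧
        (lam • aeval (fun i => ∑ j, g i j • (X j : MvPolynomial (Fin 3) k)) f =
            X 0 ^ 3 + X 1 ^ 3 + X 0 * X 1 * X 2 ∨
         lam • aeval (fun i => ∑ j, g i j • (X j : MvPolynomial (Fin 3) k)) f =
            X 1 ^ 3 + X 0 ^ 2 * X 2 ∨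
         lam • aeval (fun i => ∑ j, g i j • (X j : MvPolynomial (Fin 3) k)) f =
            X 1 ^ 3 + X 0 ^ 2 * X 2 + X 0 * X 1 ^ 2) ∧
        ((3 : k) ≠ 0 →
          (lam • aeval (fun i => ∑ j, g i j • (X j : MvPolynomial (Fin 3) k)) f =
              X 0 ^ 3 + X 1 ^ 3 + X 0 * X 1 * X 2 ∨
           lam • aeval (fun i => ∑ j, g i j • (X j : MvPolynomial (Fin 3) k)) f =
              X 1 ^ 3 + X 0 ^ 2 * X 2)) := by
  exact main11 f hirr hhom p hp hpf hpd

end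
end
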